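/- arXiv:1107.1120 — 3 statements merged into one kernel-verified Lean document; each statement's English description precedes it below -/
import Mathlib

section
/- Let v₁, v₂ ∈ μ_{q−1}. Then M_{v₁^{1−p}} = M_{v₂^{1−p}} if and only if v₁·v₂^{−1} ∈ μ_{p−1}. -/
open Polynomial Filter IntermediateField

variable (p : ℕ) [Fact p.Prime]

/-- A fixed algebraic closure of `ℚ_p`. -/
noncomputable abbrev Qpbar := AlgebraicClosure ℚ_[p]

/-- The unramified extension `K` of `ℚ_p` of degree `d` inside `ℚ̄_p`, realized as the
splitting field of `X^(p^d - 1) - 1`. -/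
noncomputable def Kur (d : ℕ) : IntermediateField ℚ_[p] (Qpbar p) :=
  IntermediateField.adjoin ℚ_[p] {x : Qpbar p | x ^ (p ^ d - 1) = 1}

/-- `ψ_u(X) = X (X + u p)^{p-1} + p` as a polynomial over `ℚ̄_p`. -/
noncomputable def psiPoly (u : Qpbar p) : Polynomial (Qpbar p) :=
  X * (X + C (u * (p : Qpbar p))) ^ (p - 1) + C (p : Qpbar p)

/-- `M_u`: the splitting field of `ψ_u` over `K` inside `ℚ̄_p`. -/
noncomputable def Mfield (d : ℕ) (u : Qpbar p) : IntermediateField (Kur p d) (Qpbar p) :=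
  IntermediateField.adjoin (Kur p d) {x : Qpbar p | (psiPoly p u).IsRoot x}


theorem s5_norm_sub_le {L : Type*} [NormedField L] [IsUltrametricDist L] (x y : L) :
    ‖x - y‖ ≤ max ‖x‖ ‖y‖ := by
  rw [sub_eq_add_neg, ← norm_neg y]; exact IsUltrametricDist.norm_add_le_max x (-y)

/-- ultrametric: strictly dominated perturbation -/
theorem s5_norm_eq {L : Type*} [NormedField L] [IsUltrametricDist L] {x y : L}
    (h : ‖x - y‖ < ‖y‖) : ‖x‖ = ‖y‖ := by
  have := IsUltrametricDist.norm_add_eq_max_of_norm_ne_norm h.ne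
  rw [sub_add_cancel, max_eq_right h.le] at this
  exact this

theorem s5_nat_le {L : Type*} [NormedField L] [IsUltrametricDist L] (n : ℕ) : ‖(n : L)‖ ≤ 1 :=
  IsUltrametricDist.norm_natCast_le_one L n

theorem s5_cross {L : Type*} [NormedField L] [IsUltrametricDist L] {q : ℕ} (hq : q.Prime)
    {s : ℝ} (hs : 0 < s) (hs1 : s < 1) (hsp : ‖(q : L)‖ = s ^ q) (z δ : L) (hz : ‖z‖ = s⁻¹) :
    ‖(z + δ) ^ q - z ^ q - δ ^ q‖ ≤ s * ‖δ‖ * max 1 ‖δ‖ ^ (q - 1) := by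
  have h := (Commute.all δ z).add_pow_prime_eq' hq
  have h2 : (z + δ) ^ q - z ^ q - δ ^ q =
      ∑ k ∈ Finset.Ioo 0 q, (q : L) * (δ ^ k * z ^ (q - k) * ((q.choose k / q : ℕ) : L)) := by
    rw [add_comm z δ, h, Finset.mul_sum]; ring
  rw [h2]
  apply IsUltrametricDist.norm_sum_le_of_forall_le_of_nonneg (by positivity)
  intro k hk
  rw [Finset.mem_Ioo] at hk
  rw [norm_mul, norm_mul, norm_mul, norm_pow, norm_pow, hz, hsp]
  obtain ⟨m, rfl⟩ : ∃ m, q = k + m := ⟨q - k, by omega⟩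
  obtain ⟨k, rfl⟩ : ∃ k', k = k' + 1 := ⟨k - 1, by omega⟩
  have e1 : s ^ (k + 1 + m) * (s⁻¹) ^ (k + 1 + m - (k + 1)) = s ^ (k + 1) := by
    rw [Nat.add_sub_cancel_left, pow_add, mul_assoc, ← mul_pow, mul_inv_cancel₀ hs.ne']; simp
  have e2 : s ^ k ≤ 1 := pow_le_one₀ hs.le hs1.le
  have e3 : ‖δ‖ ^ k ≤ max 1 ‖δ‖ ^ (k + 1 + m - 1) :=
    (pow_le_pow_left₀ (norm_nonneg _) (le_max_right _ _) k).trans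
      (pow_le_pow_right₀ (le_max_left _ _) (by omega))
  have e4 := s5_nat_le (L := L) ((k + 1 + m).choose (k + 1) / (k + 1 + m))
  calc s ^ (k + 1 + m) * (‖δ‖ ^ (k + 1) * (s⁻¹) ^ (k + 1 + m - (k + 1)) *
        ‖(((k + 1 + m).choose (k + 1) / (k + 1 + m) : ℕ) : L)‖)
      = (s ^ (k + 1 + m) * (s⁻¹) ^ (k + 1 + m - (k + 1))) * ‖δ‖ ^ (k + 1) *
        ‖(((k + 1 + m).choose (k + 1) / (k + 1 + m) : ℕ) : L)‖ := by ring
    _ ≤ s ^ (k + 1) * ‖δ‖ ^ (k + 1) * 1 := by rw [e1]; gcongr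
    _ = s * ‖δ‖ * (s ^ k * ‖δ‖ ^ k) := by ring
    _ ≤ s * ‖δ‖ * (1 * max 1 ‖δ‖ ^ (k + 1 + m - 1)) := by gcongr
    _ = _ := by ring

/-- norm of a solution of `z^p - u z = -1/p`. -/
theorem s5_root_norm {L : Type*} [NormedField L] [IsUltrametricDist L] {q : ℕ} (hq : q.Prime)
    {s : ℝ} (hs : 0 < s) (hs1 : s < 1) (hsp : ‖(q : L)‖ = s ^ q) (u z : L) (hu : ‖u‖ = 1)
    (hz : z ^ q - u * z = -((q : L)⁻¹)) : ‖z‖ = s⁻¹ := by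
  have h1 : ‖z ^ q - u * z‖ = (s⁻¹) ^ q := by rw [hz, norm_neg, norm_inv, hsp, inv_pow]
  have hs' : 1 < s⁻¹ := (one_lt_inv₀ hs).2 hs1
  have hgt : 1 < ‖z‖ := by
    by_contra hle
    push Not at hle
    have : ‖z ^ q - u * z‖ ≤ 1 := by
      refine (s5_norm_sub_le _ _).trans (max_le ?_ ?_)
      · rw [norm_pow]; exact pow_le_one₀ (norm_nonneg _) hle
      · rw [norm_mul, hu, one_mul]; exact hle
    have h3 : 1 < (s⁻¹) ^ q := one_lt_pow₀ hs' hq.ne_zero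
    linarith
  have h4 : ‖z ^ q - u * z‖ = ‖z ^ q‖ := by
    apply s5_norm_eq
    rw [show z ^ q - u * z - z ^ q = -(u * z) by ring, norm_neg, norm_mul, hu, one_mul, norm_pow]
    exact lt_self_pow₀ hgt hq.one_lt
  rw [h1, norm_pow] at h4
  exact ((pow_left_inj₀ (norm_nonneg _) (by positivity) hq.ne_zero).1 h4.symm)

/-- difference of two roots. -/
theorem s5_diff {L : Type*} [NormedField L] [IsUltrametricDist L] {q : ℕ} (hq : q.Prime)
    {s : ℝ} (hs : 0 < s) (hs1 : s < 1) (hsp : ‖(q : L)‖ = s ^ q) (u z δ : L) (hu : ‖u‖ = 1)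
    (hz : ‖z‖ = s⁻¹) (h : (z + δ) ^ q - u * (z + δ) = z ^ q - u * z) (hδ : δ ≠ 0) :
    ‖δ‖ = 1 ∧ ‖δ ^ q - u * δ‖ < 1 := by
  have hc := s5_cross hq hs hs1 hsp z δ hz
  rw [show (z + δ) ^ q - z ^ q - δ ^ q = -(δ ^ q - u * δ) by linear_combination h, norm_neg] at hc
  have hδ0 : 0 < ‖δ‖ := norm_pos_iff.2 hδ
  have hle : ‖δ‖ ≤ 1 := by
    by_contra hgt
    push Not at hgt
    rw [max_eq_right hgt.le, mul_assoc, ← pow_succ', Nat.sub_add_cancel hq.one_le] at hc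
    have h4 : ‖δ ^ q - u * δ‖ = ‖δ ^ q‖ := by
      apply s5_norm_eq
      rw [show δ ^ q - u * δ - δ ^ q = -(u * δ) by ring, norm_neg, norm_mul, hu, one_mul, norm_pow]
      exact lt_self_pow₀ hgt hq.one_lt
    rw [h4, norm_pow] at hc
    have : 0 < ‖δ‖ ^ q := by positivity
    nlinarith
  rw [max_eq_left hle, one_pow, mul_one] at hc
  have h5 : s * ‖δ‖ < ‖δ‖ := by nlinarith
  refine ⟨?_, by linarith⟩
  have h6 : ‖δ ^ q‖ = ‖u * δ‖ := by
    apply s5_norm_eq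
    rw [norm_mul u δ, hu, one_mul]; linarith
  rw [norm_pow, norm_mul, hu, one_mul] at h6
  by_contra hne
  have : ‖δ‖ ^ q < ‖δ‖ := pow_lt_self_of_lt_one₀ hδ0 (lt_of_le_of_ne hle hne) hq.one_lt
  linarith

/-- a solution of `T^p ≡ T` is congruent to an integer -/
theorem s5_int {L : Type*} [NormedField L] [IsUltrametricDist L] {q : ℕ} (hq : q.Prime)
    (hlt : ‖(q : L)‖ < 1) (T : L) (hT : ‖T‖ ≤ 1) (h : ‖T ^ q - T‖ < 1) :
    ∃ j : ℤ, ‖T - j‖ < 1 := by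
  have : Fact q.Prime := ⟨hq⟩
  let P : ℤ[X] := X ^ q - X - ∏ a : ZMod q, (X - C (a.val : ℤ))
  have hP : P.map (Int.castRingHom (ZMod q)) = 0 := by
    have h1 : (X ^ q - X : (ZMod q)[X]) = ∏ a : ZMod q, (X - C a) := by
      have hr := FiniteField.roots_X_pow_card_sub_X (ZMod q)
      rw [ZMod.card] at hr
      have hm : (X ^ q - X : (ZMod q)[X]).Monic := by
        apply monic_X_pow_sub
        rw [degree_X]; exact_mod_cast hq.one_lt
      have := prod_multiset_X_sub_C_of_monic_of_roots_card_eq hm (by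
        rw [hr, FiniteField.X_pow_card_sub_X_natDegree_eq _ hq.one_lt]
        simp [ZMod.card])
      rw [hr] at this
      rw [← this]; rfl
    simp only [P, Polynomial.map_sub, Polynomial.map_pow, map_X, Polynomial.map_prod, map_C]
    rw [h1, sub_eq_zero]
    refine Finset.prod_congr rfl fun a _ => ?_
    simp
  have hdvd : C (q : ℤ) ∣ P := by
    rw [C_dvd_iff_dvd_coeff]
    intro i
    have := congrArg (fun f => coeff f i) hP
    simp only [coeff_map, coeff_zero] at this
    exact (ZMod.intCast_zmod_eq_zero_iff_dvd _ _).1 this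
  obtain ⟨g, hg⟩ := hdvd
  have hev : T ^ q - T - ∏ a : ZMod q, (T - ((a.val : ℤ) : L)) = (q : L) * aeval T g := by
    have := congrArg (aeval T) hg
    simp only [P, map_sub, map_pow, aeval_X, map_prod, map_mul, aeval_C] at this
    simpa only [eq_intCast, Int.cast_natCast] using this
  have hgT : ‖aeval T g‖ ≤ 1 := by
    rw [aeval_eq_sum_range]
    apply IsUltrametricDist.norm_sum_le_of_forall_le_of_nonneg zero_le_one
    intro i _
    rw [zsmul_eq_mul, norm_mul, norm_pow]
    exact mul_le_one₀ (IsUltrametricDist.norm_intCast_le_one L _) (by positivity)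
      (pow_le_one₀ (norm_nonneg _) hT)
  have hprod : ‖∏ a : ZMod q, (T - ((a.val : ℤ) : L))‖ < 1 := by
    rw [show ∏ a : ZMod q, (T - ((a.val : ℤ) : L)) = (T ^ q - T) - (q : L) * aeval T g by
      rw [← hev]; ring]
    refine (s5_norm_sub_le _ _).trans_lt (max_lt h ?_)
    rw [norm_mul]
    nlinarith [norm_nonneg (q : L), norm_nonneg (aeval T g)]
  by_contra hcon
  push Not at hcon
  rw [norm_prod] at hprod
  have : (1 : ℝ) ≤ ∏ a : ZMod q, ‖T - ((a.val : ℤ) : L)‖ := by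
    calc (1 : ℝ) = ∏ a : ZMod q, 1 := by simp
      _ ≤ _ := Finset.prod_le_prod (fun _ _ => zero_le_one) (fun a _ => hcon _)
  linarith

/-- prime-to-p roots of unity are determined by their residue -/
theorem s5_rou {L : Type*} [NormedField L] [IsUltrametricDist L] {n : ℕ}
    (hn : ‖(n : L)‖ = 1) (x : L) (hx : x ^ n = 1) (h : ‖x - 1‖ < 1) : x = 1 := by
  by_contra hne
  have h1 : ∑ i ∈ Finset.range n, x ^ i = 0 := by
    have := mul_geom_sum x n
    rw [hx, sub_self, mul_eq_zero] at this
    exact this.resolve_left (sub_ne_zero.2 hne)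
  have hx1 : ‖x‖ = 1 := by
    rw [← norm_one (α := L)]; apply s5_norm_eq; rw [norm_one]; exact h
  have h2 : ‖∑ i ∈ Finset.range n, (x ^ i - 1)‖ ≤ ‖x - 1‖ := by
    apply IsUltrametricDist.norm_sum_le_of_forall_le_of_nonneg (norm_nonneg _)
    intro i _
    rw [← mul_geom_sum, norm_mul]
    have : ‖∑ i ∈ Finset.range i, x ^ i‖ ≤ 1 := by
      apply IsUltrametricDist.norm_sum_le_of_forall_le_of_nonneg zero_le_one
      intro k _
      rw [norm_pow, hx1, one_pow]
    nlinarith [norm_nonneg (x - 1)]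
  rw [Finset.sum_sub_distrib, h1] at h2
  simp [hn] at h2
  linarith

/-- terms with distinct nonzero norms are all bounded by their sum -/
theorem s5_terms {L : Type*} [NormedField L] [IsUltrametricDist L] {ι : Type*} (t : Finset ι)
    (f : ι → L) (h : ∀ i ∈ t, ∀ j ∈ t, f i ≠ 0 → f j ≠ 0 → ‖f i‖ = ‖f j‖ → i = j) (i : ι)
    (hi : i ∈ t) : ‖f i‖ ≤ ‖∑ j ∈ t, f j‖ := by
  classical
  by_cases h0 : f i = 0
  · rw [h0, norm_zero]; exact norm_nonneg _
  rw [← Finset.sum_filter_ne_zero]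
  have hmem : i ∈ t.filter (fun j => f j ≠ 0) := by simp [hi, h0]
  rw [IsUltrametricDist.norm_sum_eq_sup'_of_pairwise_ne ⟨i, hmem⟩]
  · exact Finset.le_sup' (fun j => ‖f j‖) hmem
  · intro a ha b hb hab heq
    simp only [Finset.coe_filter, Set.mem_ofPred_eq] at ha hb
    exact hab (h a ha.1 b hb.1 ha.2 hb.2 heq)

/-- `(z+η)^i - z^i` bound -/
theorem s5_powdiff {L : Type*} [NormedField L] [IsUltrametricDist L] (z w : L)
    (hw : ‖w‖ = ‖z‖) (hd : ‖w - z‖ ≤ 1) (i : ℕ) :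
    ‖w ^ i - z ^ i‖ * ‖z‖ ≤ ‖z‖ ^ i := by
  rcases Nat.eq_zero_or_pos i with rfl | hi
  · simp
  obtain ⟨m, rfl⟩ : ∃ m, i = m + 1 := ⟨i - 1, by omega⟩
  rw [← (Commute.all w z).mul_geom_sum₂, norm_mul, pow_succ]
  gcongr
  have : ‖∑ k ∈ Finset.range (m + 1), w ^ k * z ^ (m + 1 - 1 - k)‖ ≤ ‖z‖ ^ m := by
    apply IsUltrametricDist.norm_sum_le_of_forall_le_of_nonneg (by positivity)
    intro k hk
    rw [Finset.mem_range] at hk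
    rw [norm_mul, norm_pow, norm_pow, hw, ← pow_add]
    apply le_of_eq; congr 1; omega
  calc _ ≤ 1 * ‖z‖ ^ m := by gcongr
    _ = _ := one_mul _

theorem s5_norm_p : ‖(p : Qpbar p)‖ = (p : ℝ)⁻¹ := by
  rw [← map_natCast (algebraMap ℚ_[p] (Qpbar p)), PadicAlgCl.norm_extends, Padic.norm_p]

theorem s5_norm_aut (σ : Qpbar p ≃ₐ[ℚ_[p]] Qpbar p) (x : Qpbar p) : ‖σ x‖ = ‖x‖ := by
  rw [← PadicAlgCl.spectralNorm_eq, ← PadicAlgCl.spectralNorm_eq]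
  exact (spectralNorm_eq_of_equiv σ x).symm

/-- the integral ring generated by `ℤ_p` and the roots of unity -/
noncomputable def s5R (d : ℕ) : Subring (Qpbar p) :=
  Subring.closure ({x : Qpbar p | x ^ (p ^ d - 1) = 1} ∪
    {x | ∃ c : ℤ_[p], x = algebraMap ℚ_[p] (Qpbar p) (c : ℚ_[p])})

theorem s5R_frob (hp : Odd p) (d : ℕ) (a : Qpbar p) (ha : a ∈ s5R p d) :
    ∃ r ∈ s5R p d, a ^ (p ^ d) = a + p * r := by
  have hpp : p.Prime := Fact.out
  have hq1 : 1 ≤ p ^ d := Nat.one_le_pow _ _ hpp.pos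
  unfold s5R at ha
  induction ha using Subring.closure_induction with
  | mem x hx =>
    rcases hx with hx | ⟨c, rfl⟩
    · refine ⟨0, zero_mem _, ?_⟩
      have hx' : x ^ (p ^ d - 1) = 1 := hx
      rw [← Nat.sub_add_cancel hq1, pow_succ, hx']; ring
    · have h0 : PadicInt.toZMod (c ^ p ^ d - c) = 0 := by
        rw [map_sub, map_pow, ZMod.pow_card_pow, sub_self]
      have h1 : c ^ p ^ d - c ∈ RingHom.ker (PadicInt.toZMod (p := p)) := h0
      rw [PadicInt.ker_toZMod, PadicInt.maximalIdeal_eq_span_p, Ideal.mem_span_singleton] at h1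
      obtain ⟨e, he⟩ := h1
      refine ⟨algebraMap ℚ_[p] (Qpbar p) (e : ℚ_[p]), Subring.subset_closure (Or.inr ⟨e, rfl⟩), ?_⟩
      have h2 : c ^ p ^ d = c + p * e := by rw [← he]; ring
      have h3 := congrArg (fun t : ℤ_[p] => algebraMap ℚ_[p] (Qpbar p) (t : ℚ_[p])) h2
      simpa using h3
  | zero => exact ⟨0, zero_mem _, by rw [zero_pow (by omega)]; ring⟩
  | one => exact ⟨0, zero_mem _, by ring⟩
  | add x y hx hy ihx ihy =>
    obtain ⟨r, hr, er⟩ := ihx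
    obtain ⟨t, ht, et⟩ := ihy
    obtain ⟨w, hw⟩ := exists_add_pow_prime_pow_eq hpp (⟨x, hx⟩ : s5R p d) ⟨y, hy⟩ d
    have hw' := congrArg (Subtype.val) hw
    simp only [Subring.coe_add, Subring.coe_mul, Subring.coe_pow, Subring.coe_natCast] at hw'
    refine ⟨r + t + x * y * w, add_mem (add_mem hr ht) (mul_mem (mul_mem hx hy) w.2), ?_⟩
    rw [hw', er, et]; ring
  | neg x hx ih =>
    obtain ⟨r, hr, er⟩ := ih
    exact ⟨-r, neg_mem hr, by rw [Odd.neg_pow hp.pow, er]; ring⟩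
  | mul x y hx hy ihx ihy =>
    obtain ⟨r, hr, er⟩ := ihx
    obtain ⟨t, ht, et⟩ := ihy
    refine ⟨x * t + r * y + p * r * t, ?_, ?_⟩
    · exact add_mem (add_mem (mul_mem hx ht) (mul_mem hr hy))
        (mul_mem (mul_mem (natCast_mem _ _) hr) ht)
    · rw [mul_pow, er, et]; ring

theorem s5R_norm_le (d : ℕ) (hd : 0 < d) (a : Qpbar p) (ha : a ∈ s5R p d) : ‖a‖ ≤ 1 := by
  have hpp : p.Prime := Fact.out
  have hq1 : 1 < p ^ d := Nat.one_lt_pow hd.ne' hpp.one_lt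
  unfold s5R at ha
  induction ha using Subring.closure_induction with
  | mem x hx =>
    rcases hx with hx | ⟨c, rfl⟩
    · have hx' : x ^ (p ^ d - 1) = 1 := hx
      have := congrArg norm hx'
      rw [norm_pow, norm_one] at this
      exact ((pow_eq_one_iff_of_nonneg (norm_nonneg _) (by omega)).1 this).le
    · rw [PadicAlgCl.norm_extends]; exact c.2
  | zero => simp
  | one => simp
  | add x y hx hy ihx ihy =>
    exact (IsUltrametricDist.norm_add_le_max x y).trans (max_le ihx ihy)
  | neg x hx ih => rwa [norm_neg]
  | mul x y hx hy ihx ihy => rw [norm_mul]; exact mul_le_one₀ ihx (norm_nonneg _) ihy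

theorem s5R_val (hp : Odd p) (d : ℕ) (hd : 0 < d) (n : ℕ) : ∀ a ∈ s5R p d, a ≠ 0 →
    ((p : ℝ)⁻¹) ^ n < ‖a‖ → ∃ k : ℕ, ‖a‖ = ((p : ℝ)⁻¹) ^ k := by
  have hpp : p.Prime := Fact.out
  have hq1 : 1 < p ^ d := Nat.one_lt_pow hd.ne' hpp.one_lt
  have hp0 : (0 : ℝ) < p := by exact_mod_cast hpp.pos
  induction n with
  | zero =>
    intro a ha _ h
    have := s5R_norm_le p d hd a ha
    rw [pow_zero] at h; linarith
  | succ n ih =>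
    intro a ha h0 h
    have h1 := s5R_norm_le p d hd a ha
    rcases h1.lt_or_eq with hlt | heq
    · obtain ⟨r, hr, er⟩ := s5R_frob p hp d a ha
      have ha0 : 0 < ‖a‖ := norm_pos_iff.2 h0
      have h2 : ‖a ^ p ^ d‖ < ‖a‖ := by
        rw [norm_pow]; exact pow_lt_self_of_lt_one₀ ha0 hlt hq1
      have h3 : ‖-((p : Qpbar p) * r)‖ = ‖a‖ := by
        apply s5_norm_eq
        rw [show -((p : Qpbar p) * r) - a = -(a ^ p ^ d) by rw [er]; ring, norm_neg]
        exact h2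
      rw [norm_neg, norm_mul, s5_norm_p] at h3
      have hr0 : r ≠ 0 := by
        rintro rfl
        rw [norm_zero, mul_zero] at h3; linarith
      obtain ⟨k, hk⟩ := ih r hr hr0 (by
        rw [← h3, pow_succ'] at h
        exact lt_of_mul_lt_mul_left h (by positivity))
      exact ⟨k + 1, by rw [← h3, hk, pow_succ']⟩
    · exact ⟨0, by simpa using heq⟩

theorem s5_K_mul (d : ℕ) (a : Qpbar p) (ha : a ∈ Kur p d) :
    ∃ n : ℕ, (p : Qpbar p) ^ n * a ∈ s5R p d := by
  have h : a ∈ (Kur p d).toSubalgebra := ha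
  unfold Kur at h
  rw [adjoin_toSubalgebra_of_isAlgebraic (fun x _ => Algebra.IsAlgebraic.isAlgebraic x)] at h
  have up : ∀ {x : Qpbar p} {n : ℕ} (m : ℕ), (p : Qpbar p) ^ n * x ∈ s5R p d →
      (p : Qpbar p) ^ (m + n) * x ∈ s5R p d := by
    intro x n m hx
    rw [pow_add, mul_assoc]
    exact mul_mem (pow_mem (_root_.natCast_mem _ _) _) hx
  induction h using Algebra.adjoin_induction with
  | mem x hx => exact ⟨0, by rw [pow_zero, one_mul]; exact Subring.subset_closure (Or.inl hx)⟩
  | algebraMap c =>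
    have hpp : p.Prime := Fact.out
    have hp0 : (0 : ℝ) < p := by exact_mod_cast hpp.pos
    obtain ⟨n, hn⟩ := pow_unbounded_of_one_lt ‖c‖ (show (1 : ℝ) < p by exact_mod_cast hpp.one_lt)
    have hle : ‖(p : ℚ_[p]) ^ n * c‖ ≤ 1 := by
      rw [norm_mul, norm_pow, Padic.norm_p, inv_pow, inv_mul_le_iff₀ (by positivity), mul_one]
      exact hn.le
    exact ⟨n, Subring.subset_closure (Or.inr ⟨⟨_, hle⟩, by simp⟩)⟩
  | add x y hx hy ihx ihy =>
    obtain ⟨n, hn⟩ := ihx (adjoin_toSubalgebra_of_isAlgebraic (fun x _ => Algebra.IsAlgebraic.isAlgebraic x) |>.symm.le hx)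
    obtain ⟨m, hm⟩ := ihy (adjoin_toSubalgebra_of_isAlgebraic (fun x _ => Algebra.IsAlgebraic.isAlgebraic x) |>.symm.le hy)
    refine ⟨m + n, ?_⟩
    rw [mul_add]
    refine add_mem (up m hn) ?_
    rw [add_comm m n]; exact up n hm
  | mul x y hx hy ihx ihy =>
    obtain ⟨n, hn⟩ := ihx (adjoin_toSubalgebra_of_isAlgebraic (fun x _ => Algebra.IsAlgebraic.isAlgebraic x) |>.symm.le hx)
    obtain ⟨m, hm⟩ := ihy (adjoin_toSubalgebra_of_isAlgebraic (fun x _ => Algebra.IsAlgebraic.isAlgebraic x) |>.symm.le hy)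
    refine ⟨n + m, ?_⟩
    rw [pow_add, mul_mul_mul_comm]
    exact mul_mem hn hm

/-- the value group of `K` is generated by `p` -/
theorem s5_K_val (hp : Odd p) (d : ℕ) (hd : 0 < d) (a : Qpbar p) (ha : a ∈ Kur p d)
    (h0 : a ≠ 0) : ∃ k : ℤ, ‖a‖ = ((p : ℝ)⁻¹) ^ k := by
  have hpp : p.Prime := Fact.out
  have hp0 : (0 : ℝ) < p := by exact_mod_cast hpp.pos
  obtain ⟨n, hn⟩ := s5_K_mul p d a ha
  have hpL : (p : Qpbar p) ≠ 0 := by exact_mod_cast hpp.ne_zero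
  have h1 : (p : Qpbar p) ^ n * a ≠ 0 := mul_ne_zero (pow_ne_zero _ hpL) h0
  obtain ⟨m, hm⟩ := exists_pow_lt_of_lt_one (norm_pos_iff.2 h1)
    (show (p : ℝ)⁻¹ < 1 from inv_lt_one_of_one_lt₀ (by exact_mod_cast hpp.one_lt))
  obtain ⟨k, hk⟩ := s5R_val p hp d hd m _ hn h1 hm
  refine ⟨(k : ℤ) - n, ?_⟩
  rw [norm_mul, norm_pow, s5_norm_p] at hk
  have hpi : ((p : ℝ)⁻¹) ≠ 0 := by positivity
  rw [zpow_sub₀ hpi, zpow_natCast, zpow_natCast, ← hk]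
  field_simp

theorem s5_transform {L : Type*} [Field L] (n : ℕ) (hn : n ≠ 0) (P u r : L) (hP : P ≠ 0)
    (h : r * (r + u * P) ^ n + P = 0) : r + u * P ≠ 0 ∧
      ((r + u * P)⁻¹) ^ (n + 1) - u * (r + u * P)⁻¹ = -(P⁻¹) := by
  have hy : r + u * P ≠ 0 := by
    intro h0
    rw [h0, zero_pow hn, mul_zero, zero_add] at h
    exact hP h
  refine ⟨hy, ?_⟩
  generalize hy' : r + u * P = y at *
  have hr : r = y - u * P := by rw [← hy']; ring
  subst hr
  have e1 : y ^ n * y⁻¹ ^ n = 1 := by rw [← mul_pow, mul_inv_cancel₀ hy, one_pow]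
  have e2 : y * y⁻¹ = 1 := mul_inv_cancel₀ hy
  have e3 : P * P⁻¹ = 1 := mul_inv_cancel₀ hP
  have e4 : y ^ (n + 1) * y⁻¹ ^ (n + 1) = 1 := by rw [← mul_pow, e2, one_pow]
  have key : P * (y⁻¹ ^ (n + 1) - u * y⁻¹ + P⁻¹) = 0 := by
    have h2 : ((y - u * P) * y ^ n + P) * y⁻¹ ^ (n + 1) = 0 := by rw [h, zero_mul]
    rw [pow_succ y⁻¹ n] at h2 e4 ⊢
    linear_combination h2 - e4 + e3 + u * P * y⁻¹ * e1
  have := (mul_eq_zero.1 key).resolve_left hP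
  linear_combination this

instance s5_gal (d : ℕ) : IsGalois (Kur p d) (Qpbar p) where

theorem s5_norm_autK (d : ℕ) (σ : Qpbar p ≃ₐ[Kur p d] Qpbar p) (x : Qpbar p) : ‖σ x‖ = ‖x‖ :=
  s5_norm_aut p (σ.restrictScalars ℚ_[p]) x

theorem s5_exists_s : ∃ s : ℝ, 0 < s ∧ s < 1 ∧ ‖(p : Qpbar p)‖ = s ^ p := by
  have hpp : p.Prime := Fact.out
  have hp0 : (0 : ℝ) < p := by exact_mod_cast hpp.pos
  have h : (((p : ℝ)⁻¹) ^ ((p : ℝ)⁻¹)) ^ p = (p : ℝ)⁻¹ :=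
    Real.rpow_inv_natCast_pow (by positivity) hpp.ne_zero
  refine ⟨((p : ℝ)⁻¹) ^ ((p : ℝ)⁻¹), by positivity, ?_, ?_⟩
  · exact Real.rpow_lt_one (by positivity)
      (inv_lt_one_of_one_lt₀ (by exact_mod_cast hpp.one_lt)) (by positivity)
  · rw [h, s5_norm_p]

theorem s5_aut_root (d : ℕ) (u z : Qpbar p) (hu : u ∈ Kur p d) (τ : Qpbar p ≃ₐ[Kur p d] Qpbar p)
    (hz : z ^ p - u * z = -((p : Qpbar p)⁻¹)) :
    (τ z) ^ p - u * τ z = -((p : Qpbar p)⁻¹) := by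
  have h1 := congrArg τ hz
  have h2 : τ u = u := τ.commutes ⟨u, hu⟩
  simpa [h2] using h1

theorem s5_krasner (d : ℕ) (u v z z' : Qpbar p) (hu : u ∈ Kur p d) (hv : v ∈ Kur p d)
    (hv1 : ‖v‖ = 1) (huv : u * v ^ (p - 1) = 1)
    (hz : z ^ p - u * z = -((p : Qpbar p)⁻¹)) (hz' : z' ^ p - u * z' = -((p : Qpbar p)⁻¹)) :
    z' ∈ (Kur p d)⟮z⟯ := by
  have hpp : p.Prime := Fact.out
  obtain ⟨s, hs, hs1, hsp⟩ := s5_exists_s p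
  have hu1 : ‖u‖ = 1 := by
    have := congrArg norm huv
    rwa [norm_mul, norm_pow, hv1, one_pow, mul_one, norm_one] at this
  rw [← InfiniteGalois.fixedField_fixingSubgroup (Kur p d)⟮z⟯,
    IntermediateField.mem_fixedField_iff]
  intro τ hτ
  have hτz : τ z = z := (_root_.mem_fixingSubgroup_iff _).1 hτ z (mem_adjoin_simple_self _ z)
  have hτv : τ v = v := τ.commutes ⟨v, hv⟩
  by_cases hδ : z' - z = 0
  · rw [sub_eq_zero.1 hδ, hτz]
  have hzn := s5_root_norm hpp hs hs1 hsp u z hu1 hz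
  have hzn' := s5_root_norm hpp hs hs1 hsp u z' hu1 hz'
  obtain ⟨hδ1, hδ2⟩ := s5_diff hpp hs hs1 hsp u z (z' - z) hu1 hzn
    (by rw [add_sub_cancel, hz, hz']) hδ
  have hvp : v ^ p * u = v := by
    have e : v ^ p = v ^ (p - 1) * v := (pow_sub_one_mul hpp.ne_zero v).symm
    rw [e]
    linear_combination v * huv
  obtain ⟨j, hj⟩ := s5_int hpp (L := Qpbar p)
    (by rw [hsp]; exact pow_lt_one₀ hs.le hs1 hpp.ne_zero) (v * (z' - z))
    (by rw [norm_mul, hv1, hδ1, one_mul])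
    (by
      rw [show (v * (z' - z)) ^ p - v * (z' - z) = v ^ p * ((z' - z) ^ p - u * (z' - z)) by
        rw [mul_pow]; linear_combination (z' - z) * hvp, norm_mul, norm_pow, hv1, one_pow, one_mul]
      exact hδ2)
  have hj2 : ‖v * (τ z' - z) - j‖ < 1 := by
    rw [← s5_norm_autK p d τ] at hj
    simpa [hτz, hτv] using hj
  have hlt : ‖τ z' - z'‖ < 1 := by
    have : ‖v * (τ z' - z')‖ < 1 := by
      rw [show v * (τ z' - z') = (v * (τ z' - z) - j) - (v * (z' - z) - j) by ring]
      exact (s5_norm_sub_le _ _).trans_lt (max_lt hj2 hj)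
    rwa [norm_mul, hv1, one_mul] at this
  by_contra hne
  have := (s5_diff hpp hs hs1 hsp u z' (τ z' - z') hu1 hzn'
    (by rw [add_sub_cancel, hz', s5_aut_root p d u z' hu τ hz']) (sub_ne_zero.2 hne)).1
  linarith

/-- basis expansion -/
theorem s5_expand (d : ℕ) (u z x : Qpbar p) (hu : u ∈ Kur p d)
    (hz : z ^ p - u * z = -((p : Qpbar p)⁻¹)) (hx : x ∈ (Kur p d)⟮z⟯) :
    ∃ a : ℕ → Kur p d, x = ∑ i ∈ Finset.range p, (a i : Qpbar p) * z ^ i := by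
  have hpp : p.Prime := Fact.out
  let Φ : (Kur p d)[X] := X ^ p + (C (-(⟨u, hu⟩ : Kur p d)) * X + C ((p : Kur p d)⁻¹))
  have hdeg : (C (-(⟨u, hu⟩ : Kur p d)) * X + C ((p : Kur p d)⁻¹)).degree < ((p : ℕ) : WithBot ℕ) :=
    degree_linear_le.trans_lt (by exact_mod_cast hpp.one_lt)
  have hm : Φ.Monic := monic_X_pow_add hdeg
  have hΦd : Φ.natDegree = p := by
    have : Φ.degree = p := by
      simp only [Φ]
      rw [degree_add_eq_left_of_degree_lt] <;> rw [degree_X_pow]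
      exact hdeg
    exact natDegree_eq_of_degree_eq_some this
  have hΦz : aeval z Φ = 0 := by
    simp only [Φ, map_add, map_pow, aeval_X, map_mul, aeval_C, map_neg, map_inv₀, map_natCast]
    rw [show algebraMap (Kur p d) (Qpbar p) ⟨u, hu⟩ = u from rfl]
    linear_combination hz
  have hx' : x ∈ Algebra.adjoin (Kur p d) {z} := by
    rw [← adjoin_simple_toSubalgebra_of_isAlgebraic (Algebra.IsAlgebraic.isAlgebraic z)]
    exact hx
  rw [Algebra.adjoin_singleton_eq_range_aeval] at hx'
  obtain ⟨f, rfl⟩ := hx'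
  refine ⟨fun i => (f %ₘ Φ).coeff i, ?_⟩
  have h1 : aeval z f = aeval z (f %ₘ Φ) := by
    conv_lhs => rw [← modByMonic_add_div f Φ]
    rw [map_add, map_mul, hΦz, zero_mul, add_zero]
  change aeval z f = _
  rw [h1, aeval_eq_sum_range' (n := p)]
  · simp only [Algebra.smul_def]; rfl
  · conv_rhs => rw [← hΦd]
    apply natDegree_modByMonic_lt _ hm
    intro h
    rw [h, natDegree_one] at hΦd
    exact hpp.ne_zero hΦd.symm

theorem s5_close {q : ℕ} (hq : 2 ≤ q) {k l : ℤ} {i j : ℕ} (hi : i < q) (hj : j < q)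
    (h : (q : ℤ) * k - i = q * l - j) : i = j := by
  have h1 : (q : ℤ) ∣ (i : ℤ) - j := ⟨k - l, by linear_combination -h⟩
  have h2 := Int.eq_zero_of_abs_lt_dvd h1 (by rw [abs_lt]; constructor <;> omega)
  omega

theorem s5_main (hp : Odd p) (d : ℕ) (hd : 0 < d) (u₁ u₂ z₁ z₂ : Qpbar p)
    (hu₁ : u₁ ∈ Kur p d) (hu₂ : u₂ ∈ Kur p d) (hn₁ : ‖u₁‖ = 1) (hn₂ : ‖u₂‖ = 1)
    (hz₁ : z₁ ^ p - u₁ * z₁ = -((p : Qpbar p)⁻¹)) (hz₂ : z₂ ^ p - u₂ * z₂ = -((p : Qpbar p)⁻¹))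
    (hmem : z₂ ∈ (Kur p d)⟮z₁⟯) : ‖u₁ - u₂‖ < 1 := by
  have hpp : p.Prime := Fact.out
  obtain ⟨s, hs, hs1, hsp⟩ := s5_exists_s p
  have hs' : 1 < s⁻¹ := (one_lt_inv₀ hs).2 hs1
  have hpinv : (p : ℝ)⁻¹ = s ^ p := by rw [← hsp, s5_norm_p]
  have hzn₁ := s5_root_norm hpp hs hs1 hsp u₁ z₁ hn₁ hz₁
  have hzn₂ := s5_root_norm hpp hs hs1 hsp u₂ z₂ hn₂ hz₂
  have hval : ∀ a ∈ Kur p d, a ≠ 0 → ∃ k : ℤ, ‖a‖ = s ^ ((p : ℤ) * k) := by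
    intro a ha h0
    obtain ⟨k, hk⟩ := s5_K_val p hp d hd a ha h0
    exact ⟨k, by rw [hk, hpinv, zpow_mul, zpow_natCast]⟩
  have hinj : Function.Injective (fun k : ℤ => s ^ k) := zpow_right_injective₀ hs hs1.ne
  -- an automorphism moving z₁
  obtain ⟨σ, hσ⟩ : ∃ σ : Qpbar p ≃ₐ[Kur p d] Qpbar p, σ z₁ ≠ z₁ := by
    by_contra hcon
    push Not at hcon
    obtain ⟨y, hy⟩ := (InfiniteGalois.mem_range_algebraMap_iff_fixed z₁).2 hcon
    have hyK : z₁ ∈ Kur p d := by rw [← hy]; exact y.2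
    have h0 : z₁ ≠ 0 := by
      rw [← norm_pos_iff, hzn₁]; positivity
    obtain ⟨k, hk⟩ := hval z₁ hyK h0
    have h1 : (p : ℤ) * k = -1 := by
      apply hinj
      change s ^ ((p : ℤ) * k) = s ^ (-1 : ℤ)
      rw [← hk, hzn₁, zpow_neg_one]
    have h2 : (p : ℤ) ∣ 1 := ⟨-k, by linear_combination h1⟩
    have h3 : p ∣ 1 := by exact_mod_cast h2
    exact hpp.one_lt.ne' (Nat.dvd_one.1 h3)
  -- z₂ - z₁ is small
  have hδ : ‖z₂ - z₁‖ < s⁻¹ := by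
    by_contra hge
    push Not at hge
    set δ := z₂ - z₁ with hδdef
    have hgt : 1 < ‖δ‖ := hs'.trans_le hge
    have hc := s5_cross hpp hs hs1 hsp z₁ δ hzn₁
    rw [max_eq_right hgt.le, mul_assoc, ← pow_succ', Nat.sub_add_cancel hpp.one_le] at hc
    have h1 : δ ^ p = (u₂ * z₂ - u₁ * z₁) - ((z₁ + δ) ^ p - z₁ ^ p - δ ^ p) := by
      rw [show z₁ + δ = z₂ by rw [hδdef]; ring]
      linear_combination hz₂ - hz₁
    have h2 : ‖u₂ * z₂ - u₁ * z₁‖ ≤ s⁻¹ := by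
      refine (s5_norm_sub_le _ _).trans (max_le ?_ ?_)
      · rw [norm_mul, hn₂, hzn₂, one_mul]
      · rw [norm_mul, hn₁, hzn₁, one_mul]
    have h3 : ‖δ‖ < ‖δ‖ ^ p := lt_self_pow₀ hgt hpp.one_lt
    have h4 : ‖δ ^ p‖ < ‖δ‖ ^ p := by
      conv_lhs => rw [h1]
      refine (s5_norm_sub_le _ _).trans_lt (max_lt ?_ ?_)
      · linarith
      · refine hc.trans_lt ?_
        have : 0 < ‖δ‖ ^ p := by positivity
        nlinarith
    rw [norm_pow] at h4
    exact lt_irrefl _ h4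
  obtain ⟨a, ha⟩ := s5_expand p d u₁ z₁ (z₂ - z₁) hu₁ hz₁
    (sub_mem hmem (mem_adjoin_simple_self _ z₁))
  have hterm : ∀ i ∈ Finset.range p, ‖(a i : Qpbar p) * z₁ ^ i‖ < s⁻¹ := by
    intro i hi
    refine lt_of_le_of_lt ?_ hδ
    rw [ha]
    refine s5_terms (Finset.range p) (fun i => (a i : Qpbar p) * z₁ ^ i) ?_ i hi
    intro i hi j hj h0i h0j hij
    obtain ⟨k, hk⟩ := hval (a i) (a i).2 (left_ne_zero_of_mul h0i)
    obtain ⟨l, hl⟩ := hval (a j) (a j).2 (left_ne_zero_of_mul h0j)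
    simp only [norm_mul, norm_pow] at hij
    rw [hk, hl, hzn₁] at hij
    refine s5_close hpp.two_le (Finset.mem_range.1 hi) (Finset.mem_range.1 hj) (k := k) (l := l) ?_
    apply hinj
    change s ^ ((p : ℤ) * k - i) = s ^ ((p : ℤ) * l - j)
    rw [zpow_sub₀ hs.ne', zpow_sub₀ hs.ne', zpow_natCast, zpow_natCast, div_eq_mul_inv,
      div_eq_mul_inv, ← inv_pow, ← inv_pow]
    exact hij
  obtain ⟨hη₁, hη₁'⟩ := s5_diff hpp hs hs1 hsp u₁ z₁ (σ z₁ - z₁) hn₁ hzn₁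
    (by rw [add_sub_cancel, hz₁, s5_aut_root p d u₁ z₁ hu₁ σ hz₁]) (sub_ne_zero.2 hσ)
  have hσδ : ‖σ (z₂ - z₁) - (z₂ - z₁)‖ < 1 := by
    have e : σ (z₂ - z₁) - (z₂ - z₁) =
        ∑ i ∈ Finset.range p, (a i : Qpbar p) * ((σ z₁) ^ i - z₁ ^ i) := by
      rw [ha, map_sum, ← Finset.sum_sub_distrib]
      refine Finset.sum_congr rfl fun i _ => ?_
      have : σ (a i : Qpbar p) = a i := σ.commutes (a i)
      rw [map_mul, map_pow, this]; ring
    rw [e]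
    obtain ⟨i, hi, hle⟩ := IsUltrametricDist.exists_norm_finsetSum_le_of_nonempty
      (Finset.nonempty_range_iff.2 hpp.ne_zero)
      (fun i => (a i : Qpbar p) * ((σ z₁) ^ i - z₁ ^ i))
    refine hle.trans_lt ?_
    have h1 := s5_powdiff z₁ (σ z₁) (s5_norm_autK p d σ z₁) hη₁.le i
    have h2 := hterm i hi
    rw [norm_mul, norm_pow] at h2
    rw [hzn₁] at h1 h2
    have h3 : ‖(a i : Qpbar p) * ((σ z₁) ^ i - z₁ ^ i)‖ * s⁻¹ < 1 * s⁻¹ := by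
      rw [norm_mul, mul_assoc, one_mul]
      exact (mul_le_mul_of_nonneg_left h1 (norm_nonneg _)).trans_lt h2
    exact lt_of_mul_lt_mul_right h3 (by positivity)
  set η₁ := σ z₁ - z₁ with hη₁def
  set η₂ := σ z₂ - z₂ with hη₂def
  have hη : ‖η₂ - η₁‖ < 1 := by
    rw [show η₂ - η₁ = σ (z₂ - z₁) - (z₂ - z₁) by rw [hη₁def, hη₂def, map_sub]; ring]
    exact hσδ
  have hη₂ : ‖η₂‖ = 1 := by
    rw [← hη₁]; apply s5_norm_eq; rw [hη₁]; exact hη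
  obtain ⟨-, hη₂'⟩ := s5_diff hpp hs hs1 hsp u₂ z₂ η₂ hn₂ hzn₂
    (by rw [hη₂def, add_sub_cancel, hz₂, s5_aut_root p d u₂ z₂ hu₂ σ hz₂])
    (by rw [← norm_pos_iff, hη₂]; exact one_pos)
  have hpow : ‖η₂ ^ p - η₁ ^ p‖ < 1 := by
    rw [← (Commute.all η₂ η₁).mul_geom_sum₂, norm_mul]
    have : ‖∑ i ∈ Finset.range p, η₂ ^ i * η₁ ^ (p - 1 - i)‖ ≤ 1 := by
      apply IsUltrametricDist.norm_sum_le_of_forall_le_of_nonneg zero_le_one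
      intro k _
      rw [norm_mul, norm_pow, norm_pow, hη₁, hη₂, one_pow, one_pow, one_mul]
    nlinarith [norm_nonneg (η₂ - η₁)]
  have hfin : ‖(u₁ - u₂) * η₁‖ < 1 := by
    rw [show (u₁ - u₂) * η₁ = ((η₂ ^ p - u₂ * η₂) - (η₁ ^ p - u₁ * η₁)) -
      ((η₂ ^ p - η₁ ^ p) - u₂ * (η₂ - η₁)) by ring]
    refine (s5_norm_sub_le _ _).trans_lt (max_lt ?_ ?_)
    · exact (s5_norm_sub_le _ _).trans_lt (max_lt hη₂' hη₁')
    · refine (s5_norm_sub_le _ _).trans_lt (max_lt hpow ?_)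
      rw [norm_mul, hn₂, one_mul]; exact hη
  rwa [norm_mul, hη₁, mul_one] at hfin

theorem s5_psi_root (u r : Qpbar p) (h : (psiPoly p u).IsRoot r) :
    r + u * p ≠ 0 ∧ ((r + u * p)⁻¹) ^ p - u * (r + u * p)⁻¹ = -((p : Qpbar p)⁻¹) := by
  have hpp : p.Prime := Fact.out
  have hpL : (p : Qpbar p) ≠ 0 := by exact_mod_cast hpp.ne_zero
  have h1 : r * (r + u * p) ^ (p - 1) + p = 0 := by
    simpa [psiPoly, IsRoot] using h
  have h2 := s5_transform (p - 1) (by have := hpp.two_le; omega) (p : Qpbar p) u r hpL h1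
  have e : p - 1 + 1 = p := Nat.sub_add_cancel hpp.one_le
  refine ⟨h2.1, ?_⟩
  have h3 := h2.2
  simp only [e] at h3
  exact h3

theorem s5_psi_exists (u : Qpbar p) : ∃ r, (psiPoly p u).IsRoot r := by
  have hpp : p.Prime := Fact.out
  apply IsAlgClosed.exists_root
  have : (psiPoly p u).natDegree ≠ 0 := by
    have hm : (X + C (u * (p : Qpbar p))).Monic := monic_X_add_C _
    have hd : (X * (X + C (u * (p : Qpbar p))) ^ (p - 1)).natDegree = p := by
      rw [monic_X.natDegree_mul (hm.pow _), hm.natDegree_pow, natDegree_X, natDegree_X_add_C]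
      have := hpp.one_le; omega
    unfold psiPoly
    rw [natDegree_add_C, hd]
    exact hpp.ne_zero
  intro h
  exact this (natDegree_eq_of_degree_eq_some h)

/-- for `v₁, v₂ ∈ μ_{q-1}`, one has `M_{v₁^{1-p}} = M_{v₂^{1-p}}` if and only
if `v₁ v₂⁻¹ ∈ μ_{p-1}`. -/
theorem statement5 (hp : Odd p) (d : ℕ) (hd : 0 < d)
    (v₁ v₂ : Qpbar p) (hv₁ : v₁ ^ (p ^ d - 1) = 1) (hv₂ : v₂ ^ (p ^ d - 1) = 1) :
    Mfield p d (v₁ ^ ((1 : ℤ) - (p : ℤ))) = Mfield p d (v₂ ^ ((1 : ℤ) - (p : ℤ))) ↔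
      (v₁ * v₂⁻¹) ^ (p - 1) = 1 := by
  have hpp : p.Prime := Fact.out
  have hq1 : 1 < p ^ d := Nat.one_lt_pow hd.ne' hpp.one_lt
  have hpow : ∀ v : Qpbar p, v ^ ((1 : ℤ) - (p : ℤ)) = (v ^ (p - 1))⁻¹ := by
    intro v
    rw [← zpow_natCast, ← zpow_neg]
    congr 1
    have := hpp.one_le
    omega
  have hne : ∀ v : Qpbar p, v ^ (p ^ d - 1) = 1 → v ≠ 0 := by
    rintro v hv rfl
    rw [zero_pow (by omega)] at hv
    exact zero_ne_one hv
  have h10 := hne _ hv₁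
  have h20 := hne _ hv₂
  rw [hpow, hpow]
  have hiff : (v₁ * v₂⁻¹) ^ (p - 1) = 1 ↔ (v₁ ^ (p - 1))⁻¹ = (v₂ ^ (p - 1))⁻¹ := by
    rw [inv_inj, mul_pow, inv_pow, mul_inv_eq_one₀ (pow_ne_zero _ h20)]
  rw [hiff]
  refine ⟨fun hM => ?_, fun h => by rw [h]⟩
  have hK : ∀ v : Qpbar p, v ^ (p ^ d - 1) = 1 → v ∈ Kur p d := fun v hv =>
    IntermediateField.subset_adjoin _ _ hv
  have hnv : ∀ v : Qpbar p, v ^ (p ^ d - 1) = 1 → ‖v‖ = 1 := by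
    intro v hv
    have := congrArg norm hv
    rw [norm_pow, norm_one] at this
    exact (pow_eq_one_iff_of_nonneg (norm_nonneg _) (by omega)).1 this
  have huq : ∀ v : Qpbar p, v ^ (p ^ d - 1) = 1 → ((v ^ (p - 1))⁻¹) ^ (p ^ d - 1) = 1 := by
    intro v hv
    rw [inv_pow, ← pow_mul, mul_comm, pow_mul, hv, one_pow, inv_one]
  have huv₁ : (v₁ ^ (p - 1))⁻¹ * v₁ ^ (p - 1) = 1 := inv_mul_cancel₀ (pow_ne_zero _ h10)
  have hq₁ := huq _ hv₁
  have hq₂ := huq _ hv₂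
  generalize (v₁ ^ (p - 1))⁻¹ = u₁ at *
  generalize (v₂ ^ (p - 1))⁻¹ = u₂ at *
  obtain ⟨r₁, hr₁⟩ := s5_psi_exists p u₁
  obtain ⟨r₂, hr₂⟩ := s5_psi_exists p u₂
  obtain ⟨hy₁, hz₁⟩ := s5_psi_root p u₁ r₁ hr₁
  obtain ⟨hy₂, hz₂⟩ := s5_psi_root p u₂ r₂ hr₂
  have hle : Mfield p d u₁ ≤ (Kur p d)⟮(r₁ + u₁ * p)⁻¹⟯ := by
    unfold Mfield
    rw [IntermediateField.adjoin_le_iff]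
    intro r hr
    obtain ⟨hy, hz⟩ := s5_psi_root p u₁ r hr
    have h1 := s5_krasner p d u₁ v₁ _ _ (hK _ hq₁) (hK _ hv₁) (hnv _ hv₁) huv₁ hz₁ hz
    have h2 := inv_mem h1
    rw [inv_inv] at h2
    have h3 : u₁ ∈ (Kur p d)⟮(r₁ + u₁ * p)⁻¹⟯ :=
      (Kur p d)⟮(r₁ + u₁ * p)⁻¹⟯.algebraMap_mem ⟨u₁, hK _ hq₁⟩
    have h4 := sub_mem h2 (mul_mem h3 (_root_.natCast_mem (Kur p d)⟮(r₁ + u₁ * p)⁻¹⟯ p))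
    rwa [add_sub_cancel_right] at h4
  have hr₂M : r₂ ∈ (Kur p d)⟮(r₁ + u₁ * p)⁻¹⟯ := by
    apply hle
    rw [hM]
    exact IntermediateField.subset_adjoin _ _ hr₂
  have hz₂M : (r₂ + u₂ * p)⁻¹ ∈ (Kur p d)⟮(r₁ + u₁ * p)⁻¹⟯ := by
    have h3 : u₂ ∈ (Kur p d)⟮(r₁ + u₁ * p)⁻¹⟯ :=
      (Kur p d)⟮(r₁ + u₁ * p)⁻¹⟯.algebraMap_mem ⟨u₂, hK _ hq₂⟩
    exact inv_mem (add_mem hr₂M (mul_mem h3 (_root_.natCast_mem _ p)))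
  have hmain := s5_main p hp d hd u₁ u₂ _ _ (hK _ hq₁) (hK _ hq₂) (hnv _ hq₁) (hnv _ hq₂)
    hz₁ hz₂ hz₂M
  have hu20 := hne _ hq₂
  have hx : u₁ / u₂ = 1 := by
    apply s5_rou (n := p ^ d - 1)
    · rw [Nat.cast_sub hq1.le, Nat.cast_one, Nat.cast_pow, ← norm_one (α := Qpbar p),
        ← norm_neg (1 : Qpbar p)]
      apply s5_norm_eq
      rw [sub_neg_eq_add, sub_add_cancel, norm_neg, norm_one, norm_pow, s5_norm_p]
      exact pow_lt_one₀ (by positivity) (inv_lt_one_of_one_lt₀ (by exact_mod_cast hpp.one_lt))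
        hd.ne'
    · rw [div_pow, hq₁, hq₂, div_one]
    · rw [show u₁ / u₂ - 1 = (u₁ - u₂) / u₂ by rw [sub_div, div_self hu20], norm_div,
        hnv _ hq₂, div_one]
      exact hmain
  exact (div_eq_one_iff_eq hu20).1 hx
end

section
/- Let v, v₁, v₂ ∈ μ_{q−1} with v₁·v₂^{−1} ∉ μ_{p−1}, and for x ∈ O_K let x̄ ∈ k denote its reduction modulo P_K. Then M_{v^{1−p}} is contained in the compositum M_{v₁^{1−p}}·M_{v₂^{1−p}} (inside ℚ̄_p) if and only if there exist a, b ∈ 𝔽_p with v̄ = a·v̄₁ + b·v̄₂ in k, i.e. if and only if v̄ lies on the projective line of ℙ(k) through v̄₁ and v̄₂. -/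
open Polynomial Filter IntermediateField

variable (p : ℕ) [Fact p.Prime]

section AbstractPart

namespace S6

open Finset

variable {p : ℕ} {L : Type*} [Field L] {N : AbsoluteValue L ℝ}

lemma add_lt (hna : IsNonarchimedean N) {x y : L} {r : ℝ} (hx : N x < r) (hy : N y < r) :
    N (x + y) < r := (hna x y).trans_lt (max_lt hx hy)

lemma add_le (hna : IsNonarchimedean N) {x y : L} {r : ℝ} (hx : N x ≤ r) (hy : N y ≤ r) :
    N (x + y) ≤ r := (hna x y).trans (max_le hx hy)

lemma neg_eq (x : L) : N (-x) = N x := N.map_neg x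

lemma sub_lt (hna : IsNonarchimedean N) {x y : L} {r : ℝ} (hx : N x < r) (hy : N y < r) :
    N (x - y) < r := by
  rw [sub_eq_add_neg]; exact add_lt hna hx (by rwa [neg_eq])

lemma sub_le (hna : IsNonarchimedean N) {x y : L} {r : ℝ} (hx : N x ≤ r) (hy : N y ≤ r) :
    N (x - y) ≤ r := by
  rw [sub_eq_add_neg]; exact add_le hna hx (by rwa [neg_eq])

lemma mul_lt {x y : L} (hx : N x ≤ 1) (hy : N y < 1) : N (x * y) < 1 := by
  rw [map_mul]
  calc N x * N y ≤ 1 * N y := by gcongr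
    _ < 1 := by simpa using hy

lemma mul_lt' {x y : L} (hx : N x < 1) (hy : N y ≤ 1) : N (x * y) < 1 := by
  rw [mul_comm]; exact mul_lt hy hx

lemma mul_le {x y : L} (hx : N x ≤ 1) (hy : N y ≤ 1) : N (x * y) ≤ 1 := by
  rw [map_mul]; exact mul_le_one₀ hx (N.nonneg _) hy

lemma pow_le {x : L} (hx : N x ≤ 1) (n : ℕ) : N (x ^ n) ≤ 1 := by
  rw [map_pow]; exact pow_le_one₀ (N.nonneg _) hx

lemma pow_lt {x : L} (hx : N x < 1) {n : ℕ} (hn : n ≠ 0) : N (x ^ n) < 1 := by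
  rw [map_pow]; exact pow_lt_one₀ (N.nonneg _) hx hn

lemma sum_lt (hna : IsNonarchimedean N) {ι : Type*} (s : Finset ι) (f : ι → L)
    (h : ∀ i ∈ s, N (f i) < 1) : N (∑ i ∈ s, f i) < 1 :=
  Finset.sum_induction f (fun x => N x < 1) (fun _ _ => add_lt hna) (by simp) h

lemma sum_le (hna : IsNonarchimedean N) {ι : Type*} (s : Finset ι) (f : ι → L)
    (h : ∀ i ∈ s, N (f i) ≤ 1) : N (∑ i ∈ s, f i) ≤ 1 :=
  Finset.sum_induction f (fun x => N x ≤ 1) (fun _ _ => add_le hna) (by simp) h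

lemma nat_le (hna : IsNonarchimedean N) (n : ℕ) : N (n : L) ≤ 1 := by
  induction n with
  | zero => simp
  | succ n ih => rw [Nat.cast_succ]; exact add_le hna ih (by simp)

variable [hpf : Fact p.Prime]

lemma p_pos : (0 : ℝ) < p := by exact_mod_cast hpf.out.pos
lemma p_gt : (1 : ℝ) < p := by exact_mod_cast hpf.out.one_lt

lemma p_ne (hNp : N (p : L) = (p : ℝ)⁻¹) : (p : L) ≠ 0 := by
  intro h; rw [h] at hNp; have := p_pos (p := p); simp at hNp; simp [hNp] at this

lemma Np_lt (hNp : N (p : L) = (p : ℝ)⁻¹) : N (p : L) < 1 := by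
  rw [hNp]; exact inv_lt_one_of_one_lt₀ p_gt

/-- `|x|^p ≤ p` implies `|x| < p`. -/
lemma lt_p {x : L} (hx : N x ^ p ≤ p) {k : ℕ} (hk : k < p) : N x ^ k < p := by
  rcases le_or_gt (N x) 1 with h | h
  · exact (pow_le_one₀ (N.nonneg _) h).trans_lt p_gt
  · exact (pow_lt_pow_right₀ h hk).trans_le hx

lemma mixed_le (hNp : N (p : L) = (p : ℝ)⁻¹) {x y : L} (hx : N x ^ p ≤ p) (hy : N y ^ p ≤ p)
    {k : ℕ} (hk : k ≤ p) : N (p * (x ^ k * y ^ (p - k))) ≤ 1 := by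
  rw [← pow_le_one_iff_of_nonneg (N.nonneg _) hpf.out.ne_zero]
  simp only [map_mul, map_pow, hNp]
  have hp0 := p_pos (p := p)
  calc ((p : ℝ)⁻¹ * (N x ^ k * N y ^ (p - k))) ^ p
      = ((p : ℝ)⁻¹) ^ p * ((N x ^ p) ^ k * (N y ^ p) ^ (p - k)) := by
        rw [mul_pow, mul_pow, ← pow_mul, ← pow_mul, ← pow_mul, ← pow_mul, mul_comm k,
          mul_comm (p - k)]
    _ ≤ ((p : ℝ)⁻¹) ^ p * ((p : ℝ) ^ k * (p : ℝ) ^ (p - k)) := by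
        have := N.nonneg x; have := N.nonneg y
        gcongr
    _ = 1 := by
        rw [← pow_add, Nat.add_sub_cancel' hk, ← mul_pow, inv_mul_cancel₀ hp0.ne', one_pow]

lemma frob_le (hna : IsNonarchimedean N) (hNp : N (p : L) = (p : ℝ)⁻¹) {x y : L}
    (hx : N x ^ p ≤ p) (hy : N y ^ p ≤ p) : N ((x + y) ^ p - (x ^ p + y ^ p)) ≤ 1 := by
  rw [add_pow_prime_eq' hpf.out, add_sub_cancel_left, mul_sum]
  refine sum_le hna _ _ fun k hk => ?_
  rw [← mul_assoc]
  exact mul_le (mixed_le hNp hx hy (mem_Ioo.1 hk).2.le) (nat_le hna _)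

lemma frob_lt (hna : IsNonarchimedean N) (hNp : N (p : L) = (p : ℝ)⁻¹) {x y : L}
    (hx : N x ^ p ≤ p) (hy : N y ≤ 1) : N ((x + y) ^ p - (x ^ p + y ^ p)) < 1 := by
  rw [add_pow_prime_eq' hpf.out, add_sub_cancel_left, mul_sum]
  refine sum_lt hna _ _ fun k hk => ?_
  rw [← mul_assoc, ← mul_assoc, mul_assoc]
  refine mul_lt' ?_ (mul_le (pow_le hy _) (nat_le hna _))
  rw [map_mul, hNp, map_pow, inv_mul_lt_one₀ p_pos]
  exact lt_p hx (mem_Ioo.1 hk).2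

lemma int_pow_le {x : L} (hx : N x ≤ 1) : N x ^ p ≤ p :=
  (pow_le_one₀ (N.nonneg _) hx).trans p_gt.le

lemma pow_inj (hna : IsNonarchimedean N) (hNp : N (p : L) = (p : ℝ)⁻¹)
    {x y : L} (hx : N x ≤ 1) (hy : N y ≤ 1) (h : N (x ^ p - y ^ p) < 1) : N (x - y) < 1 := by
  have h1 := frob_lt hna hNp (int_pow_le (p := p) (sub_le hna hx hy)) hy
  have h2 : N ((x - y) ^ p) < 1 := by
    have := sub_lt hna h h1
    rw [sub_add_cancel] at this
    convert this using 2; ring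
  by_contra hc
  rw [map_pow] at h2
  exact absurd h2 (not_lt.2 (one_le_pow₀ (not_lt.1 hc)))

lemma nat_frob (hna : IsNonarchimedean N) (hNp : N (p : L) = (p : ℝ)⁻¹) (n : ℕ) :
    N ((n : L) ^ p - n) < 1 := by
  induction n with
  | zero => simp [hpf.out.ne_zero]
  | succ n ih =>
    have h1 := frob_lt hna hNp (int_pow_le (p := p) (nat_le hna n)) (y := (1 : L)) (by simp)
    have := add_lt hna h1 ih
    push_cast
    convert this using 2; ring

/-- congruence of products -/
lemma mul_congr (hna : IsNonarchimedean N) {a b c d : L} (ha : N a ≤ 1) (hd : N d ≤ 1)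
    (h1 : N (a - b) < 1) (h2 : N (c - d) < 1) : N (a * c - b * d) < 1 := by
  have : a * c - b * d = a * (c - d) + (a - b) * d := by ring
  rw [this]; exact add_lt hna (mul_lt ha h2) (mul_lt' h1 hd)

lemma le_of_congr (hna : IsNonarchimedean N) {a b : L} (ha : N a ≤ 1) (h1 : N (a - b) < 1) :
    N b ≤ 1 := by
  have := sub_le hna ha h1.le
  simpa using this

lemma pow_congr (hna : IsNonarchimedean N) {a b : L} (ha : N a ≤ 1)
    (h1 : N (a - b) < 1) (n : ℕ) : N (a ^ n - b ^ n) < 1 := by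
  induction n with
  | zero => simp
  | succ n ih =>
    rw [pow_succ, pow_succ]
    exact mul_congr hna (pow_le ha n) (le_of_congr hna ha h1) ih h1

/-- The Artin–Schreier type relation. -/
def Rel (p : ℕ) (N : AbsoluteValue L ℝ) (w s : L) : Prop :=
  N w ^ p ≤ p ∧ N s ≤ 1 ∧ N (w ^ p - w + s ^ p / p) < 1

lemma Rel.neg (ho : Odd p) {w s : L} (h : Rel p N w s) : Rel p N (-w) (-s) := by
  refine ⟨by rw [neg_eq]; exact h.1, by rw [neg_eq]; exact h.2.1, ?_⟩
  have h3 := h.2.2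
  rw [← neg_eq] at h3
  rw [ho.neg_pow, ho.neg_pow]
  convert h3 using 2; ring

lemma pw_lt (hNp : N (p : L) = (p : ℝ)⁻¹) {x : L} (hx : N x ^ p ≤ p) : N (p * x) < 1 := by
  rw [map_mul, hNp, inv_mul_lt_one₀ p_pos]
  simpa using lt_p hx hpf.out.one_lt

lemma Rel.scaled (hna : IsNonarchimedean N) (hNp : N (p : L) = (p : ℝ)⁻¹) {w s : L}
    (h : Rel p N w s) : N (p * w ^ p) ≤ 1 ∧ N (p * w ^ p - (-s ^ p)) < 1 := by
  constructor
  · rw [map_mul, map_pow, hNp, inv_mul_le_one₀ p_pos]; exact h.1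
  · have h1 := mul_lt (nat_le hna p) h.2.2
    have h2 := add_lt hna h1 (pw_lt hNp h.1)
    convert h2 using 2
    have := p_ne hNp
    field_simp; ring

lemma Rel.add (ho : Odd p) (hna : IsNonarchimedean N) (hNp : N (p : L) = (p : ℝ)⁻¹)
    {w s w' s' : L} (h : Rel p N w s) (h' : Rel p N w' s') : Rel p N (w + w') (s + s') := by
  have hpne := p_ne hNp
  refine ⟨?_, add_le hna h.2.1 h'.2.1, ?_⟩
  · rcases le_total (N w) (N w') with hl | hl
    · exact (pow_le_pow_left₀ (N.nonneg _) ((hna w w').trans (by simp [hl])) p).trans h'.1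
    · exact (pow_le_pow_left₀ (N.nonneg _) ((hna w w').trans (by simp [hl])) p).trans h.1
  have key : ∀ k ∈ Ioo 0 p, N (p * (w ^ k * w' ^ (p - k)) + s ^ k * s' ^ (p - k)) < 1 := by
    intro k hk
    have hk' := (mem_Ioo.1 hk).2
    rw [← sub_neg_eq_add]
    refine pow_inj hna hNp (mixed_le hNp h.1 h'.1 hk'.le) ?_ ?_
    · rw [neg_eq]; exact mul_le (pow_le h.2.1 _) (pow_le h'.2.1 _)
    · obtain ⟨a1, a2⟩ := h.scaled hna hNp
      obtain ⟨b1, b2⟩ := h'.scaled hna hNp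
      have := mul_congr hna (pow_le a1 k) (le_of_congr hna (pow_le b1 (p - k))
        (pow_congr hna b1 b2 (p - k))) (pow_congr hna a1 a2 k) (pow_congr hna b1 b2 (p - k))
      convert this using 2
      have e : (p : L) ^ k * (p : L) ^ (p - k) = (p : L) ^ p := by
        rw [← pow_add, Nat.add_sub_cancel' hk'.le]
      have e2 : (-1 : L) ^ k * (-1 : L) ^ (p - k) = -1 := by
        rw [← pow_add, Nat.add_sub_cancel' hk'.le, ho.neg_one_pow]
      rw [ho.neg_pow, neg_pow (s ^ p), neg_pow (s' ^ p)]
      simp only [mul_pow, ← pow_mul]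
      rw [mul_mul_mul_comm, e, mul_mul_mul_comm, e2, mul_comm k, mul_comm (p - k)]
      ring
  have hsum : N (∑ k ∈ Ioo 0 p, (p * (w ^ k * w' ^ (p - k)) + s ^ k * s' ^ (p - k)) *
      ((p.choose k / p : ℕ) : L)) < 1 :=
    sum_lt hna _ _ fun k hk => mul_lt' (key k hk) (nat_le hna _)
  have := add_lt hna (add_lt hna h.2.2 h'.2.2) hsum
  convert this using 2
  rw [add_pow_prime_eq' hpf.out, add_pow_prime_eq' hpf.out s s']
  simp only [add_mul, sum_add_distrib, mul_assoc, ← mul_sum]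
  field_simp
  ring

lemma Rel.zero : Rel p N (0 : L) 0 := by
  refine ⟨?_, ?_, ?_⟩ <;> simp [hpf.out.ne_zero]

lemma Rel.natMul (ho : Odd p) (hna : IsNonarchimedean N) (hNp : N (p : L) = (p : ℝ)⁻¹)
    {w s : L} (h : Rel p N w s) (n : ℕ) : Rel p N (n * w) (n * s) := by
  induction n with
  | zero => simpa using Rel.zero
  | succ n ih =>
    push_cast
    rw [add_mul, add_mul, one_mul, one_mul]
    exact ih.add ho hna hNp h

lemma Rel.perturb (ho : Odd p) (hna : IsNonarchimedean N) (hNp : N (p : L) = (p : ℝ)⁻¹)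
    {w s v : L} (h : Rel p N w s) (hv : N (v - s) ≤ (p : ℝ)⁻¹) : Rel p N w v := by
  have h0 : Rel p N 0 (v - s) := by
    have hlt : (p : ℝ)⁻¹ < 1 := inv_lt_one_of_one_lt₀ p_gt
    have h1 : N (v - s) ≤ 1 := hv.trans hlt.le
    refine ⟨by simp [hpf.out.ne_zero], h1, ?_⟩
    simp only [zero_pow hpf.out.ne_zero, sub_zero, zero_add]
    obtain ⟨m, hm⟩ : ∃ m, p = m + 2 := ⟨p - 2, by have := hpf.out.two_le; omega⟩
    have e : (v - s) ^ p / (p : L) = (v - s) ^ (p - 1) * ((v - s) / p) := by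
      rw [← mul_div_assoc, ← pow_succ, Nat.sub_add_cancel hpf.out.one_le]
    rw [e]
    refine mul_lt' (pow_lt (hv.trans_lt hlt) (by omega)) ?_
    rw [map_div₀, hNp]
    exact div_le_one_of_le₀ hv (by positivity)
  have := h.add ho hna hNp h0
  simpa using this



lemma zmod_inj (hna : IsNonarchimedean N) (hNp : N (p : L) = (p : ℝ)⁻¹) {n m : ZMod p}
    (h : N ((n.val : L) - (m.val : L)) < 1) : n = m := by
  by_contra hne
  have hz : ¬ ((p : ℤ) ∣ ((n.val : ℤ) - m.val)) := by
    intro hd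
    apply hne
    rw [← ZMod.intCast_zmod_eq_zero_iff_dvd] at hd
    push_cast at hd
    simpa [sub_eq_zero] using hd
  have hc : IsCoprime (p : ℤ) ((n.val : ℤ) - m.val) :=
    (Prime.coprime_iff_not_dvd (Nat.prime_iff_prime_int.1 hpf.out)).2 hz
  obtain ⟨a, b, hab⟩ := hc
  have hint : ∀ a : ℤ, N (a : L) ≤ 1 := by
    intro a
    obtain ⟨k, rfl | rfl⟩ := a.eq_nat_or_neg
    · simpa using nat_le hna k
    · rw [Int.cast_neg, neg_eq]; simpa using nat_le hna k
  have h1 : N ((a : L) * p + b * ((n.val : L) - m.val)) < 1 :=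
    add_lt hna (mul_lt (hint a) (Np_lt hNp)) (mul_lt (hint b) h)
  have h2 : ((a : L) * p + b * ((n.val : L) - m.val)) = 1 := by exact_mod_cast congrArg (Int.cast (R := L)) hab
  rw [h2] at h1
  simp at h1

lemma zmod_val_natCast (hna : IsNonarchimedean N) (hNp : N (p : L) = (p : ℝ)⁻¹) (k : ℕ) :
    N ((k : L) - (((k : ZMod p).val : ℕ) : L)) < 1 := by
  rw [ZMod.val_natCast]
  have e : (k : L) - ((k % p : ℕ) : L) = ((k / p : ℕ) : L) * p := by
    rw [sub_eq_iff_eq_add]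
    rw [← Nat.cast_mul, ← Nat.cast_add, Nat.div_add_mod' k p]
  rw [e]
  exact mul_lt (nat_le hna _) (Np_lt hNp)

/-- Polynomials that are approximately `X^p - X + s^p/p`. -/
structure Good (p : ℕ) (N : AbsoluteValue L ℝ) (P : L[X]) (s : L) : Prop where
  monic : P.Monic
  deg : P.natDegree = p
  approx : ∀ x, N x ^ p ≤ p → N (P.eval x - (x ^ p - x + s ^ p / p)) < 1
  bound : ∀ r, P.eval r = 0 → N r ^ p ≤ p
  le_one : N s ≤ 1

lemma Good.root_rel {P : L[X]} {s : L} (h : Good p N P s) {r : L} (hr : P.eval r = 0) :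
    Rel p N r s := by
  refine ⟨h.bound r hr, h.le_one, ?_⟩
  have := h.approx r (h.bound r hr)
  rwa [hr, zero_sub, neg_eq] at this

lemma Good.near [IsAlgClosed L] (hna : IsNonarchimedean N) {P : L[X]} {s : L} (h : Good p N P s)
    {x : L} (hx : Rel p N x s) : ∃ r, P.eval r = 0 ∧ N (x - r) < 1 := by
  have h1 : N (P.eval x) < 1 := by
    have := add_lt hna (h.approx x hx.1) hx.2.2
    simpa using this
  by_contra hc
  push Not at hc
  have hs := (IsAlgClosed.splits P).eq_prod_roots_of_monic h.monic
  have : ∀ m : Multiset L, (∀ r ∈ m, P.eval r = 0) →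
      1 ≤ N ((m.map fun a => X - C a).prod.eval x) := by
    intro m
    induction m using Multiset.induction with
    | empty => simp
    | cons a m ih =>
      intro hm
      simp only [Multiset.map_cons, Multiset.prod_cons, eval_mul, eval_sub, eval_X, eval_C, map_mul]
      exact one_le_mul_of_one_le_of_one_le (hc a (hm a (by simp)))
        (ih fun r hr => hm r (by simp [hr]))
  have h2 := this P.roots fun r hr => (mem_roots'.1 hr).2
  rw [← hs] at h2
  exact absurd h1 (not_lt.2 h2)

lemma Rel.natCast (hna : IsNonarchimedean N) (hNp : N (p : L) = (p : ℝ)⁻¹) (n : ℕ) :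
    Rel p N (n : L) 0 := by
  refine ⟨int_pow_le (nat_le hna n), by simp, ?_⟩
  simpa [hpf.out.ne_zero] using nat_frob hna hNp n

lemma Good.param [IsAlgClosed L] (ho : Odd p) (hna : IsNonarchimedean N)
    (hNp : N (p : L) = (p : ℝ)⁻¹) {P : L[X]} {s : L}
    (h : Good p N P s) {x : L} (hx : Rel p N x s) :
    ∃ f : ZMod p → L, (∀ n, N (x + (n.val : L) - f n) < 1) ∧ ∀ r, P.eval r = 0 → ∃ n, f n = r := by
  have h1 : ∀ n : ZMod p, ∃ r, P.eval r = 0 ∧ N (x + (n.val : L) - r) < 1 := by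
    intro n
    apply h.near hna
    simpa using hx.add ho hna hNp (Rel.natCast hna hNp n.val)
  choose f hf hf2 using h1
  refine ⟨f, hf2, ?_⟩
  have hinj : Function.Injective f := by
    intro n m hnm
    apply zmod_inj hna hNp
    have := sub_lt hna (hf2 n) (hf2 m)
    rw [hnm] at this
    convert this using 2; ring
  let g : ZMod p → {r // r ∈ P.rootSet L} := fun n => ⟨f n, by
    rw [mem_rootSet]; exact ⟨h.monic.ne_zero, by simpa using hf n⟩⟩
  have hginj : Function.Injective g := fun a b hab => hinj (congrArg Subtype.val hab)
  have hcard : Nat.card {r // r ∈ P.rootSet L} ≤ Nat.card (ZMod p) := by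
    rw [Nat.card_zmod, ← h.deg]
    simpa [Set.ncard] using! P.ncard_rootSet_le L
  have hb := hginj.bijective_of_nat_card_le hcard
  intro r hr
  obtain ⟨n, hn⟩ := hb.2 ⟨r, by rw [mem_rootSet]; exact ⟨h.monic.ne_zero, by simpa using hr⟩⟩
  exact ⟨n, congrArg Subtype.val hn⟩

/-- Any root is close to an integral translate. -/
lemma Good.diff [IsAlgClosed L] (ho : Odd p) (hna : IsNonarchimedean N)
    (hNp : N (p : L) = (p : ℝ)⁻¹) {P : L[X]} {s : L}
    (h : Good p N P s) {x : L} (hx : Rel p N x s) {r : L} (hr : P.eval r = 0) :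
    ∃ n : ZMod p, N (r - x - (n.val : L)) < 1 := by
  obtain ⟨f, hf, hf2⟩ := h.param ho hna hNp hx
  obtain ⟨n, rfl⟩ := hf2 r hr
  refine ⟨n, ?_⟩
  rw [← neg_eq]; convert hf n using 2; ring

/-- Roots are separated. -/
lemma Good.sep [IsAlgClosed L] (ho : Odd p) (hna : IsNonarchimedean N)
    (hNp : N (p : L) = (p : ℝ)⁻¹) {P : L[X]} {s : L}
    (h : Good p N P s) {r r' : L} (hr : P.eval r = 0) (hr' : P.eval r' = 0)
    (hlt : N (r - r') < 1) : r = r' := by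
  obtain ⟨f, hf, hf2⟩ := h.param ho hna hNp (h.root_rel hr)
  obtain ⟨n, hn⟩ := hf2 r hr
  obtain ⟨m, hm⟩ := hf2 r' hr'
  have : n = m := by
    apply zmod_inj hna hNp
    have := add_lt hna (sub_lt hna (hf n) (hf m)) hlt
    rw [hn, hm] at this
    convert this using 2; ring
  rw [← hn, ← hm, this]

/-- The polynomial `X^p - X + s^p/p`. -/
noncomputable def asPoly (p : ℕ) (s : L) : L[X] := X ^ p + (-X + C (s ^ p / p))

lemma asPoly_good (hna : IsNonarchimedean N) (hNp : N (p : L) = (p : ℝ)⁻¹) {s : L}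
    (hs : N s ≤ 1) : Good p N (asPoly p s) s := by
  have hd : (-X + C (s ^ p / p) : L[X]).natDegree < p := by
    refine lt_of_le_of_lt ?_ hpf.out.one_lt
    compute_degree
  refine ⟨?_, ?_, ?_, ?_, hs⟩
  · exact monic_X_pow_add (degree_le_natDegree.trans_lt (by exact_mod_cast hd))
  · unfold asPoly
    rw [natDegree_add_eq_left_of_natDegree_lt (by simpa using hd), natDegree_X_pow]
  · intro x _
    have : (asPoly p s).eval x - (x ^ p - x + s ^ p / p) = 0 := by simp [asPoly]; ring
    rw [this]; simp
  · intro r hr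
    have h0 : r ^ p = r - s ^ p / p := by
      simp [asPoly] at hr; linear_combination hr
    by_contra hc
    push Not at hc
    have h1 : N (s ^ p / p) ≤ p := by
      rw [map_div₀, hNp, div_inv_eq_mul]
      exact mul_le_of_le_one_left p_pos.le (pow_le hs p)
    have hr1 : 1 < N r := by
      by_contra hc2
      exact absurd ((pow_le_one₀ (N.nonneg _) (not_lt.1 hc2)).trans_lt p_gt) (not_lt.2 hc.le)
    have hr2 : N r < N r ^ p := by simpa using pow_lt_pow_right₀ hr1 hpf.out.one_lt
    have := sub_lt hna hr2 (h1.trans_lt hc)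
    rw [← h0, map_pow] at this
    exact lt_irrefl _ this

/-- The transformed `ψ`. -/
noncomputable def hPoly (p : ℕ) (v : L) : L[X] :=
  X ^ p + C (v ^ p / p) * (1 + C (p / v ^ p) * X) ^ (p - 1)

lemma one_add_pow_eq (hna : IsNonarchimedean N) {y : L} (hy : N y ≤ 1) (m : ℕ) :
    ∃ T, N T ≤ 1 ∧ (1 + y) ^ m = 1 + m * y + y ^ 2 * T := by
  induction m with
  | zero => exact ⟨0, by simp, by simp⟩
  | succ m ih =>
    obtain ⟨T, hT, h⟩ := ih
    refine ⟨T * (1 + y) + m, add_le hna (mul_le hT (add_le hna (by simp) hy)) (nat_le hna m), ?_⟩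
    rw [pow_succ, h]; push_cast; ring

lemma hPoly_eval (v x : L) : (hPoly p v).eval x =
    x ^ p + v ^ p / p * (1 + p / v ^ p * x) ^ (p - 1) := by
  simp [hPoly]

lemma hPoly_good (ho : Odd p) (hna : IsNonarchimedean N) (hNp : N (p : L) = (p : ℝ)⁻¹) {v : L}
    (hv : N v = 1) : Good p N (hPoly p v) v := by
  have hpne := p_ne hNp
  have hv0 : v ≠ 0 := by rintro rfl; simp at hv
  have hp3 : 2 < p := by
    have := hpf.out.two_le
    rcases ho with ⟨k, hk⟩; omega
  have hd : (C (v ^ p / p) * (1 + C (p / v ^ p) * X) ^ (p - 1) : L[X]).natDegree < p := by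
    have : (C (v ^ p / p) * (1 + C (p / v ^ p) * X) ^ (p - 1) : L[X]).natDegree ≤ p - 1 := by
      compute_degree
    omega
  refine ⟨?_, ?_, ?_, ?_, hv.le⟩
  · exact monic_X_pow_add (degree_le_natDegree.trans_lt (by exact_mod_cast hd))
  · unfold hPoly
    rw [natDegree_add_eq_left_of_natDegree_lt (by simpa using hd), natDegree_X_pow]
  · intro x hx
    have hy : N (p / v ^ p * x) < 1 := by
      have := pw_lt hNp hx
      simpa [hv] using this
    obtain ⟨T, hT, h⟩ := one_add_pow_eq hna hy.le (p - 1)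
    have e : (hPoly p v).eval x - (x ^ p - x + v ^ p / p) =
        p * x + p * x ^ 2 * (T / v ^ p) := by
      rw [hPoly_eval, h, Nat.cast_sub hpf.out.one_le]
      field_simp
      push_cast
      ring
    rw [e]
    refine add_lt hna (pw_lt hNp hx) (mul_lt' ?_ ?_)
    · rw [map_mul, map_pow, hNp, inv_mul_lt_one₀ p_pos]
      exact lt_p hx hp3
    · simpa [hv] using hT
  · intro r hr
    rw [hPoly_eval] at hr
    by_contra hc
    push Not at hc
    have h0 : N r ^ p = p * N (1 + p / v ^ p * r) ^ (p - 1) := by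
      have : r ^ p = -(v ^ p / p * (1 + p / v ^ p * r) ^ (p - 1)) := by linear_combination hr
      rw [← map_pow, this, neg_eq]
      simp [hv, hNp]
    have hr1 : 1 < N r := by
      by_contra hc2
      exact absurd ((pow_le_one₀ (N.nonneg _) (not_lt.1 hc2)).trans_lt p_gt) (not_lt.2 hc.le)
    have h1 : N (1 + p / v ^ p * r) ≤ max 1 (N r / p) := by
      refine (hna _ _).trans (le_of_eq ?_)
      simp [hv, hNp]; ring_nf
    have hp0 := p_pos (p := p)
    rcases le_total (N r / p) 1 with h2 | h2
    · rw [max_eq_left h2] at h1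
      have := pow_le_one₀ (n := p - 1) (N.nonneg _) h1
      rw [h0] at hc
      nlinarith
    · rw [max_eq_right h2] at h1
      have h3 := pow_le_pow_left₀ (N.nonneg _) h1 (p - 1)
      have h4 : N r ^ p ≤ p * (N r / p) ^ (p - 1) := by rw [h0]; gcongr
      have h5 : p * (N r / p) ^ (p - 1) ≤ N r ^ (p - 1) := by
        rw [div_pow, mul_div_assoc', div_le_iff₀ (by positivity), mul_comm]
        have : (p : ℝ) ≤ p ^ (p - 1) := by
          calc (p : ℝ) = p ^ 1 := (pow_one _).symm
            _ ≤ p ^ (p - 1) := pow_le_pow_right₀ p_gt.le (by omega)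
        gcongr
      have h6 : N r ^ (p - 1) < N r ^ p := pow_lt_pow_right₀ hr1 (by omega)
      linarith

lemma exists_root [IsAlgClosed L] {P : L[X]} {s : L} (h : Good p N P s) : ∃ r, P.eval r = 0 := by
  have : P.degree ≠ 0 := by
    rw [degree_eq_natDegree h.monic.ne_zero, h.deg]
    exact_mod_cast hpf.out.ne_zero
  exact IsAlgClosed.exists_root P this

lemma Good.root_ne_zero (hNp : N (p : L) = (p : ℝ)⁻¹) {v w : L} (hv : v ≠ 0)
    (h : (hPoly p v).eval w = 0) : w ≠ 0 := by
  rintro rfl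
  rw [hPoly_eval] at h
  simp [hpf.out.ne_zero, p_ne hNp, hv] at h

lemma psi_hPoly (hNp : N (p : L) = (p : ℝ)⁻¹) {v x : L} (hv : v ≠ 0) (hx : x ≠ 0) :
    x * (x + v ^ ((1 : ℤ) - (p : ℤ)) * p) ^ (p - 1) + p =
      (p / (v / x) ^ p) * (hPoly p v).eval (v / x) := by
  have hpne := p_ne hNp
  rw [hPoly_eval, zpow_sub₀ hv, zpow_one, zpow_natCast]
  have e : x + v / v ^ p * p = x * (1 + p / v ^ p * (v / x)) := by field_simp
  rw [e, mul_pow, ← mul_assoc, mul_pow_sub_one hpf.out.ne_zero]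
  generalize (1 + p / v ^ p * (v / x)) ^ (p - 1) = A
  rw [div_pow]
  field_simp
  ring

/-- linear algebra over `𝔽_p` -/
lemma lin_alg (S : Submodule (ZMod p) (ZMod p × ZMod p × ZMod p))
    (h : ∀ c, ((0, 0, c) : ZMod p × ZMod p × ZMod p) ∈ S → c = 0) :
    ∃ a b : ZMod p, ∀ x ∈ S, x.2.2 = a * x.1 + b * x.2.1 := by
  let l1 : S →ₗ[ZMod p] ZMod p := (LinearMap.fst _ _ _) ∘ₗ S.subtype
  let l2 : S →ₗ[ZMod p] ZMod p := (LinearMap.fst _ _ _) ∘ₗ (LinearMap.snd _ _ _) ∘ₗ S.subtype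
  let l3 : S →ₗ[ZMod p] ZMod p := (LinearMap.snd _ _ _) ∘ₗ (LinearMap.snd _ _ _) ∘ₗ S.subtype
  have hk : ⨅ i, LinearMap.ker (![l1, l2] i) ≤ LinearMap.ker l3 := by
    intro x hx
    simp only [Submodule.mem_iInf, LinearMap.mem_ker, Fin.forall_fin_two] at hx ⊢
    obtain ⟨⟨x1, x2, x3⟩, hxS⟩ := x
    simp [l1, l2, l3] at hx ⊢
    obtain ⟨rfl, rfl⟩ := hx
    exact h _ hxS
  have := mem_span_of_iInf_ker_le_ker hk
  rw [Matrix.range_cons, Matrix.range_cons, Matrix.range_empty, Set.union_empty,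
    Set.singleton_union, Submodule.mem_span_pair] at this
  obtain ⟨a, b, hab⟩ := this
  refine ⟨a, b, fun x hx => ?_⟩
  have := LinearMap.congr_fun hab ⟨x, hx⟩
  simpa [l1, l2, l3] using this.symm

end S6
end AbstractPart

namespace S6

open Finset

section Concrete

variable {p} {abv : AbsoluteValue (Qpbar p) ℝ}

lemma abv_eq (habv : ∀ x : ℚ_[p], abv (algebraMap ℚ_[p] (Qpbar p) x) = ‖x‖) (x : Qpbar p) :
    abv x = spectralNorm ℚ_[p] (Qpbar p) x := spectralNorm_unique_field_norm_ext habv x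

lemma abv_na (habv : ∀ x : ℚ_[p], abv (algebraMap ℚ_[p] (Qpbar p) x) = ‖x‖) :
    IsNonarchimedean abv := by
  intro x y
  rw [abv_eq habv, abv_eq habv, abv_eq habv]
  exact isNonarchimedean_spectralNorm x y

lemma abv_p (habv : ∀ x : ℚ_[p], abv (algebraMap ℚ_[p] (Qpbar p) x) = ‖x‖) :
    abv (p : Qpbar p) = (p : ℝ)⁻¹ := by
  have := habv (p : ℚ_[p])
  rwa [map_natCast, Padic.norm_p] at this

lemma abv_gal (habv : ∀ x : ℚ_[p], abv (algebraMap ℚ_[p] (Qpbar p) x) = ‖x‖) {d : ℕ}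
    (σ : (Qpbar p) ≃ₐ[Kur p d] (Qpbar p)) (x : Qpbar p) : abv (σ x) = abv x := by
  rw [abv_eq habv, abv_eq habv]
  exact (spectralNorm_eq_of_equiv (σ.restrictScalars ℚ_[p]) x).symm

/-- The ring `ℤ_p[μ_{q-1}]`. -/
noncomputable def Bring (p : ℕ) [Fact p.Prime] (d : ℕ) : Subalgebra ℤ_[p] (Qpbar p) :=
  Algebra.adjoin ℤ_[p] {x : Qpbar p | x ^ (p ^ d - 1) = 1}

lemma root_norm {d : ℕ} (hd : 0 < d) {v : Qpbar p} (hv : v ^ (p ^ d - 1) = 1) : abv v = 1 := by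
  have hq : p ^ d - 1 ≠ 0 := by
    have := Nat.one_lt_pow hd.ne' (Fact.out : p.Prime).one_lt
    omega
  have := congrArg abv hv
  rw [map_pow, map_one] at this
  exact (pow_eq_one_iff_of_nonneg (abv.nonneg _) hq).1 this

lemma zp_alg (x : ℤ_[p]) : algebraMap ℤ_[p] (Qpbar p) x = algebraMap ℚ_[p] (Qpbar p) (x : ℚ_[p]) := by
  rw [IsScalarTower.algebraMap_apply ℤ_[p] ℚ_[p] (Qpbar p)]; rfl

lemma Bring_le {d : ℕ} (hd : 0 < d)
    (habv : ∀ x : ℚ_[p], abv (algebraMap ℚ_[p] (Qpbar p) x) = ‖x‖) {b : Qpbar p}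
    (hb : b ∈ Bring p d) : abv b ≤ 1 := by
  induction hb using Algebra.adjoin_induction with
  | mem x hx => exact (root_norm hd hx).le
  | algebraMap r => rw [zp_alg, habv]; exact r.2
  | add x y _ _ hx hy => exact S6.add_le (abv_na habv) hx hy
  | mul x y _ _ hx hy => exact S6.mul_le hx hy

lemma zp_frob (r : ℤ_[p]) (d : ℕ) : ∃ t : ℤ_[p], r ^ (p ^ d) - r = p * t := by
  have : r ^ (p ^ d) - r ∈ RingHom.ker (PadicInt.toZMod (p := p)) := by
    rw [RingHom.mem_ker, map_sub, map_pow, ZMod.pow_card_pow, sub_self]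
  rw [PadicInt.ker_toZMod, PadicInt.maximalIdeal_eq_span_p, Ideal.mem_span_singleton] at this
  exact this

lemma Bring_frob {d : ℕ} {b : Qpbar p} (hb : b ∈ Bring p d) :
    ∃ t ∈ Bring p d, b ^ (p ^ d) - b = p * t := by
  have hpp : p.Prime := Fact.out
  induction hb using Algebra.adjoin_induction with
  | mem x hx =>
    refine ⟨0, zero_mem _, ?_⟩
    have : p ^ d = (p ^ d - 1) + 1 := by
      have := Nat.pow_pos (n := d) hpp.pos
      omega
    rw [this, pow_succ, hx]; simp
  | algebraMap r =>
    obtain ⟨t, ht⟩ := zp_frob r d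
    refine ⟨algebraMap _ _ t, Subalgebra.algebraMap_mem _ _, ?_⟩
    have := congrArg (algebraMap ℤ_[p] (Qpbar p)) ht
    simpa using this
  | add x y hx hy ihx ihy =>
    obtain ⟨t, ht, e⟩ := ihx
    obtain ⟨t', ht', e'⟩ := ihy
    refine ⟨t + t' + ∑ k ∈ Ioo 0 (p ^ d), x ^ k * y ^ (p ^ d - k) * ↑((p ^ d).choose k / p),
      add_mem (add_mem ht ht') (sum_mem fun k _ => mul_mem (mul_mem (pow_mem hx _) (pow_mem hy _))
        (_root_.natCast_mem _ _)), ?_⟩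
    rw [add_pow_prime_pow_eq' hpp]
    linear_combination e + e'
  | mul x y hx hy ihx ihy =>
    obtain ⟨t, ht, e⟩ := ihx
    obtain ⟨t', ht', e'⟩ := ihy
    refine ⟨x ^ (p ^ d) * t' + t * y, add_mem (mul_mem (pow_mem hx _) ht') (mul_mem ht hy), ?_⟩
    rw [mul_pow]
    linear_combination x ^ (p ^ d) * e' + y * e

lemma Bring_frob_iter {d : ℕ} {b : Qpbar p} (hb : b ∈ Bring p d) (n : ℕ) :
    ∃ t ∈ Bring p d, b ^ ((p ^ d) ^ n) - b = p * t := by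
  induction n with
  | zero => exact ⟨0, zero_mem _, by simp⟩
  | succ n ih =>
    obtain ⟨t, ht, e⟩ := ih
    obtain ⟨t', ht', e'⟩ := Bring_frob (pow_mem hb ((p ^ d) ^ n))
    refine ⟨t + t', add_mem ht ht', ?_⟩
    rw [pow_succ (p ^ d) n, pow_mul]
    linear_combination e + e'

lemma Bring_div {d : ℕ} (hd : 0 < d)
    (habv : ∀ x : ℚ_[p], abv (algebraMap ℚ_[p] (Qpbar p) x) = ‖x‖) {b : Qpbar p}
    (hb : b ∈ Bring p d) (hlt : abv b < 1) : ∃ t ∈ Bring p d, b = p * t := by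
  have hpp : p.Prime := Fact.out
  set P := minpoly ℚ_[p] b with hP
  have hint : IsIntegral ℚ_[p] b := Algebra.IsIntegral.isIntegral b
  have hmon : P.Monic := minpoly.monic hint
  have hdeg : 0 < P.natDegree := minpoly.natDegree_pos hint
  have hc : ∀ i, i < P.natDegree → ∃ t : ℤ_[p], P.coeff i = p * t := by
    intro i hi
    have h1 : ‖P.coeff i‖ < 1 := by
      have h2 : spectralValueTerms P i < 1 := by
        refine (le_ciSup (spectralValueTerms_bddAbove P) i).trans_lt ?_
        rw [abv_eq habv] at hlt
        exact hlt
      rw [spectralValueTerms_of_lt_natDegree P hi] at h2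
      by_contra hc
      have : (0 : ℝ) ≤ 1 / ((P.natDegree : ℝ) - i) := by
        have : (i : ℝ) < P.natDegree := by exact_mod_cast hi
        exact div_nonneg zero_le_one (by linarith)
      exact absurd h2 (not_lt.2 (Real.one_le_rpow (not_lt.1 hc) this))
    obtain ⟨z, hz⟩ : ∃ z : ℤ_[p], (z : ℚ_[p]) = P.coeff i := ⟨⟨P.coeff i, h1.le⟩, rfl⟩
    have h3 : z ∈ Ideal.span {(p : ℤ_[p])} := by
      rw [← PadicInt.maximalIdeal_eq_span_p, IsLocalRing.mem_maximalIdeal, PadicInt.mem_nonunits,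
        PadicInt.norm_def, hz]
      exact h1
    rw [Ideal.mem_span_singleton] at h3
    obtain ⟨t, ht⟩ := h3
    exact ⟨t, by rw [← hz, ht]; simp⟩
  choose! c hc using hc
  have hpow : ∃ t ∈ Bring p d, b ^ P.natDegree = p * t := by
    have h0 := minpoly.aeval ℚ_[p] b
    rw [← hP, aeval_eq_sum_range, sum_range_succ, hmon.coeff_natDegree, one_smul] at h0
    refine ⟨- ∑ i ∈ range P.natDegree, algebraMap ℤ_[p] (Qpbar p) (c i) * b ^ i,
      neg_mem (sum_mem fun i _ => mul_mem (Subalgebra.algebraMap_mem _ _) (pow_mem hb _)), ?_⟩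
    rw [mul_neg, mul_sum, eq_neg_iff_add_eq_zero, add_comm, ← h0]
    congr 1
    refine sum_congr rfl fun i hi => ?_
    rw [hc i (mem_range.1 hi), Algebra.smul_def, map_mul, map_natCast, zp_alg]
    ring
  obtain ⟨t, ht, e⟩ := hpow
  obtain ⟨t', ht', e'⟩ := Bring_frob_iter hb P.natDegree
  have hle : P.natDegree ≤ (p ^ d) ^ P.natDegree :=
    (Nat.lt_pow_self (Nat.one_lt_pow hd.ne' hpp.one_lt)).le
  refine ⟨t * b ^ ((p ^ d) ^ P.natDegree - P.natDegree) - t', sub_mem (mul_mem ht (pow_mem hb _)) ht', ?_⟩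
  have : b ^ ((p ^ d) ^ P.natDegree) =
      b ^ P.natDegree * b ^ ((p ^ d) ^ P.natDegree - P.natDegree) := by
    rw [← pow_add, Nat.add_sub_cancel' hle]
  rw [this, e] at e'
  linear_combination -e'

lemma Kur_denom {d : ℕ} {x : Qpbar p} (hx : x ∈ Kur p d) :
    ∃ m : ℕ, (p : Qpbar p) ^ m * x ∈ Bring p d := by
  have hx' : x ∈ Algebra.adjoin ℚ_[p] {x : Qpbar p | x ^ (p ^ d - 1) = 1} := by
    rw [← IntermediateField.adjoin_toSubalgebra]
    exact hx
  clear hx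
  induction hx' using Algebra.adjoin_induction with
  | mem y hy =>
    refine ⟨0, ?_⟩
    rw [pow_zero, one_mul]
    exact Algebra.subset_adjoin (R := ℤ_[p]) hy
  | algebraMap r =>
    obtain ⟨m, hm⟩ : ∃ m : ℕ, ‖(p : ℚ_[p]) ^ m * r‖ ≤ 1 := by
      obtain ⟨m, hm⟩ := pow_unbounded_of_one_lt ‖r‖ (p_gt (p := p))
      refine ⟨m, ?_⟩
      rw [norm_mul, norm_pow, Padic.norm_p, inv_pow, inv_mul_le_one₀ (pow_pos p_pos m)]
      exact hm.le
    refine ⟨m, ?_⟩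
    obtain ⟨z, hz⟩ : ∃ z : ℤ_[p], (z : ℚ_[p]) = (p : ℚ_[p]) ^ m * r := ⟨⟨_, hm⟩, rfl⟩
    have := Subalgebra.algebraMap_mem (Bring p d) z
    rw [zp_alg, hz] at this
    simpa using this
  | add x y hx hy ihx ihy =>
    obtain ⟨m, hm⟩ := ihx
    obtain ⟨n, hn⟩ := ihy
    refine ⟨m + n, ?_⟩
    have e : (p : Qpbar p) ^ (m + n) * (x + y) =
      (p : Qpbar p) ^ n * (p ^ m * x) + (p : Qpbar p) ^ m * (p ^ n * y) := by ring
    rw [e]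
    exact add_mem (mul_mem (pow_mem (_root_.natCast_mem _ _) _) hm) (mul_mem (pow_mem (_root_.natCast_mem _ _) _) hn)
  | mul x y hx hy ihx ihy =>
    obtain ⟨m, hm⟩ := ihx
    obtain ⟨n, hn⟩ := ihy
    refine ⟨m + n, ?_⟩
    have e : (p : Qpbar p) ^ (m + n) * (x * y) = (p ^ m * x) * (p ^ n * y) := by ring
    rw [e]
    exact mul_mem hm hn

lemma Bring_val {d : ℕ} (hd : 0 < d)
    (habv : ∀ x : ℚ_[p], abv (algebraMap ℚ_[p] (Qpbar p) x) = ‖x‖) (n : ℕ) :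
    ∀ b ∈ Bring p d, abv b ^ p * (p : ℝ) ^ n = 1 → p ∣ n := by
  have hpp : p.Prime := Fact.out
  have hp0 := p_pos (p := p)
  induction n using Nat.strong_induction_on with
  | _ n ih =>
  intro b hb hbn
  rcases Nat.eq_zero_or_pos n with rfl | hn
  · simp
  have hlt : abv b < 1 := by
    by_contra hc
    have h1 := one_le_pow₀ (n := p) (not_lt.1 hc)
    have h2 := one_lt_pow₀ (p_gt (p := p)) hn.ne'
    nlinarith
  obtain ⟨t, ht, rfl⟩ := Bring_div hd habv hb hlt
  rw [map_mul, abv_p habv, mul_pow] at hbn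
  rcases lt_or_ge n p with h | h
  · exfalso
    have h1 := pow_le_one₀ (n := p) (abv.nonneg _) (Bring_le hd habv ht)
    have h2 : ((p : ℝ)⁻¹) ^ p * p ^ n < 1 := by
      rw [inv_pow, inv_mul_lt_one₀ (by positivity)]
      exact pow_lt_pow_right₀ p_gt h
    have h3 : (0 : ℝ) ≤ ((p : ℝ)⁻¹) ^ p * p ^ n := by positivity
    have : ((p : ℝ)⁻¹) ^ p * p ^ n * abv t ^ p = 1 := by rw [← hbn]; ring
    nlinarith
  · obtain ⟨m, rfl⟩ := Nat.exists_eq_add_of_le h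
    have : p ∣ m := by
      refine ih m (by have := hpp.pos; omega) t ht ?_
      rw [← hbn, pow_add, inv_pow]
      field_simp
    exact (Nat.dvd_add_right (dvd_refl p)).2 this

lemma Kur_val {d : ℕ} (hd : 0 < d)
    (habv : ∀ x : ℚ_[p], abv (algebraMap ℚ_[p] (Qpbar p) x) = ‖x‖) {x : Qpbar p}
    (hx : x ∈ Kur p d) : abv x ^ p ≠ p := by
  have hpp : p.Prime := Fact.out
  have hp0 := p_pos (p := p)
  intro h
  obtain ⟨m, hm⟩ := Kur_denom hx
  have hm1 : 0 < m := by
    rcases Nat.eq_zero_or_pos m with rfl | h0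
    · have h1 := pow_le_one₀ (n := p) (abv.nonneg _) (Bring_le hd habv hm)
      simp [h] at h1
      have := hpp.one_lt
      omega
    · exact h0
  have hmp : 1 ≤ m * p := Nat.mul_pos hm1 hpp.pos
  have := Bring_val hd habv (m * p - 1) _ hm (by
    rw [map_mul, map_pow, abv_p habv, mul_pow, h, mul_assoc, mul_pow_sub_one (by omega), inv_pow,
      inv_pow, ← pow_mul]
    field_simp)
  have h2 : p ∣ 1 := by
    have h3 := Nat.dvd_sub (Dvd.intro_left m rfl) this
    rwa [Nat.sub_sub_self hmp] at h3
  exact hpp.one_lt.ne' (Nat.dvd_one.1 h2)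


lemma Kur_mem {d : ℕ} {v : Qpbar p} (hv : v ^ (p ^ d - 1) = 1) : v ∈ Kur p d :=
  IntermediateField.subset_adjoin _ _ hv

lemma gal_Kur {d : ℕ} {v : Qpbar p} (hv : v ∈ Kur p d)
    (σ : (Qpbar p) ≃ₐ[Kur p d] (Qpbar p)) : σ v = v :=
  σ.commutes ⟨v, hv⟩

lemma h_gal {d : ℕ} {v : Qpbar p} (hv : v ∈ Kur p d)
    (σ : (Qpbar p) ≃ₐ[Kur p d] (Qpbar p)) {w : Qpbar p} (hw : (hPoly p v).eval w = 0) :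
    (hPoly p v).eval (σ w) = 0 := by
  rw [hPoly_eval] at hw ⊢
  have := congrArg σ hw
  simpa [gal_Kur hv σ] using this

lemma as_gal {d : ℕ} {s : Qpbar p} (hs : s ∈ Kur p d)
    (σ : (Qpbar p) ≃ₐ[Kur p d] (Qpbar p)) {w : Qpbar p} (hw : (asPoly p s).eval w = 0) :
    (asPoly p s).eval (σ w) = 0 := by
  simp only [asPoly, eval_add, eval_pow, eval_X, eval_neg, eval_C] at hw ⊢
  have := congrArg σ hw
  simpa [gal_Kur hs σ] using this

lemma M_le (habv : ∀ x : ℚ_[p], abv (algebraMap ℚ_[p] (Qpbar p) x) = ‖x‖) {d : ℕ} (hd : 0 < d)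
    {v : Qpbar p} (hv : v ^ (p ^ d - 1) = 1)
    (F : IntermediateField (Kur p d) (Qpbar p)) :
    Mfield p d (v ^ ((1 : ℤ) - (p : ℤ))) ≤ F ↔ ∀ w, (hPoly p v).eval w = 0 → w ∈ F := by
  have hNp := abv_p habv
  have hpne := p_ne hNp
  have hvF : v ∈ F := F.algebraMap_mem ⟨v, Kur_mem hv⟩
  have hv0 : v ≠ 0 := by
    have := root_norm (abv := abv) hd hv
    rintro rfl; simp at this
  unfold Mfield
  rw [IntermediateField.adjoin_le_iff]
  have hpsi : ∀ x, (psiPoly p (v ^ ((1 : ℤ) - (p : ℤ)))).IsRoot x ↔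
      x * (x + v ^ ((1 : ℤ) - (p : ℤ)) * p) ^ (p - 1) + p = 0 := by
    intro x
    simp [psiPoly, Polynomial.IsRoot]
  constructor
  · intro h w hw
    have hw0 := Good.root_ne_zero hNp hv0 hw
    have hx : v / w ∈ F := by
      apply h
      rw [Set.mem_setOf_eq, hpsi, psi_hPoly hNp hv0 (div_ne_zero hv0 hw0), div_div_cancel₀ hv0, hw,
        mul_zero]
    have := F.div_mem hvF hx
    rwa [div_div_cancel₀ hv0] at this
  · intro h x hx
    rw [Set.mem_setOf_eq, hpsi] at hx
    have hx0 : x ≠ 0 := by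
      rintro rfl
      simp [hpne] at hx
    rw [psi_hPoly hNp hv0 hx0] at hx
    have h1 : (hPoly p v).eval (v / x) = 0 :=
      (mul_eq_zero.1 hx).resolve_left (div_ne_zero hpne (pow_ne_zero _ (div_ne_zero hv0 hx0)))
    have := F.div_mem hvF (h _ h1)
    rwa [div_div_cancel₀ hv0] at this

lemma mem_of_fixed {d : ℕ} (F : IntermediateField (Kur p d) (Qpbar p)) {x : Qpbar p}
    (h : ∀ σ : (Qpbar p) ≃ₐ[Kur p d] (Qpbar p), (∀ y ∈ F, σ y = y) → σ x = x) : x ∈ F := by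
  rw [← InfiniteGalois.fixedField_fixingSubgroup F, IntermediateField.mem_fixedField_iff]
  intro σ hσ
  exact h σ ((IntermediateField.mem_fixingSubgroup_iff _ _).1 hσ)

/-- If `σ` does not move `x` and `x` is an approximate root, then `σ` fixes all roots. -/
lemma fix_all (ho : Odd p) (habv : ∀ x : ℚ_[p], abv (algebraMap ℚ_[p] (Qpbar p) x) = ‖x‖) {d : ℕ}
    {P : (Qpbar p)[X]} {s : Qpbar p} (h : Good p abv P s)
    (σ : (Qpbar p) ≃ₐ[Kur p d] (Qpbar p)) (hP : ∀ w, P.eval w = 0 → P.eval (σ w) = 0)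
    {z : Qpbar p} (hz : Rel p abv z s) (hσ : abv (σ z - z) < 1)
    {w : Qpbar p} (hw : P.eval w = 0) : σ w = w := by
  have hna := abv_na habv
  obtain ⟨n, hn⟩ := h.diff ho hna (abv_p habv) hz hw
  refine h.sep ho hna (abv_p habv) (hP w hw) hw ?_
  have h1 : abv (σ (w - z - (n.val : Qpbar p))) < 1 := by rwa [abv_gal habv]
  have := S6.sub_lt hna (S6.add_lt hna h1 hσ) hn
  convert this using 2
  simp only [map_sub, map_natCast]
  ring

theorem main_if (ho : Odd p) {d : ℕ} (hd : 0 < d)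
    (habv : ∀ x : ℚ_[p], abv (algebraMap ℚ_[p] (Qpbar p) x) = ‖x‖)
    {v v₁ v₂ : Qpbar p}
    (hv : v ^ (p ^ d - 1) = 1) (hv₁ : v₁ ^ (p ^ d - 1) = 1) (hv₂ : v₂ ^ (p ^ d - 1) = 1)
    (a b : ZMod p) (hab : abv (v - (a.val : Qpbar p) * v₁ - (b.val : Qpbar p) * v₂) < 1) :
    Mfield p d (v ^ ((1 : ℤ) - (p : ℤ))) ≤
        Mfield p d (v₁ ^ ((1 : ℤ) - (p : ℤ))) ⊔ Mfield p d (v₂ ^ ((1 : ℤ) - (p : ℤ))) := by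
  have hna := abv_na habv
  have hNp := abv_p habv
  have g := hPoly_good ho hna hNp (root_norm hd hv)
  have g₁ := hPoly_good ho hna hNp (root_norm hd hv₁)
  have g₂ := hPoly_good ho hna hNp (root_norm hd hv₂)
  obtain ⟨w₁, hw₁⟩ := exists_root g₁
  obtain ⟨w₂, hw₂⟩ := exists_root g₂
  set F := Mfield p d (v₁ ^ ((1 : ℤ) - (p : ℤ))) ⊔ Mfield p d (v₂ ^ ((1 : ℤ) - (p : ℤ))) with hF
  have hw₁F : w₁ ∈ F := (M_le habv hd hv₁ F).1 le_sup_left _ hw₁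
  have hw₂F : w₂ ∈ F := (M_le habv hd hv₂ F).1 le_sup_right _ hw₂
  have hz := ((g₁.root_rel hw₁).natMul ho hna hNp a.val).add ho hna hNp
    ((g₂.root_rel hw₂).natMul ho hna hNp b.val)
  have hsub : ∀ {u : Qpbar p}, u ^ (p ^ d - 1) = 1 → u ∈ Bring p d := fun hu =>
    Algebra.subset_adjoin (R := ℤ_[p]) hu
  have hB : v - (a.val : Qpbar p) * v₁ - (b.val : Qpbar p) * v₂ ∈ Bring p d :=
    sub_mem (sub_mem (hsub hv) (mul_mem (_root_.natCast_mem _ _) (hsub hv₁)))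
      (mul_mem (_root_.natCast_mem _ _) (hsub hv₂))
  obtain ⟨t, ht, e⟩ := Bring_div hd habv hB hab
  have hzv := hz.perturb ho hna hNp (v := v) (by
    have e' : v - ((a.val : Qpbar p) * v₁ + (b.val : Qpbar p) * v₂) = p * t := by
      rw [← e]; ring
    rw [e', map_mul, hNp]
    exact mul_le_of_le_one_right (inv_nonneg.2 p_pos.le) (Bring_le hd habv ht))
  rw [M_le habv hd hv]
  intro w hw
  refine mem_of_fixed F fun σ hσ => ?_
  refine fix_all ho habv g σ (fun w hw => h_gal (Kur_mem hv) σ hw) hzv ?_ hw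
  rw [map_add, map_mul, map_mul, map_natCast, map_natCast, hσ w₁ hw₁F, hσ w₂ hw₂F, sub_self,
    map_zero]
  exact zero_lt_one

theorem main_only_if (ho : Odd p) {d : ℕ} (hd : 0 < d)
    (habv : ∀ x : ℚ_[p], abv (algebraMap ℚ_[p] (Qpbar p) x) = ‖x‖)
    {v v₁ v₂ : Qpbar p}
    (hv : v ^ (p ^ d - 1) = 1) (hv₁ : v₁ ^ (p ^ d - 1) = 1) (hv₂ : v₂ ^ (p ^ d - 1) = 1)
    (hM : Mfield p d (v ^ ((1 : ℤ) - (p : ℤ))) ≤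
        Mfield p d (v₁ ^ ((1 : ℤ) - (p : ℤ))) ⊔ Mfield p d (v₂ ^ ((1 : ℤ) - (p : ℤ)))) :
    ∃ a b : ZMod p, abv (v - (a.val : Qpbar p) * v₁ - (b.val : Qpbar p) * v₂) < 1 := by
  have hna := abv_na habv
  have hNp := abv_p habv
  have g := hPoly_good ho hna hNp (root_norm hd hv)
  have g₁ := hPoly_good ho hna hNp (root_norm hd hv₁)
  have g₂ := hPoly_good ho hna hNp (root_norm hd hv₂)
  obtain ⟨w, hw⟩ := exists_root g
  obtain ⟨w₁, hw₁⟩ := exists_root g₁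
  obtain ⟨w₂, hw₂⟩ := exists_root g₂
  -- the relation "σ moves x by n"
  let R : ((Qpbar p) ≃ₐ[Kur p d] (Qpbar p)) → Qpbar p → ZMod p → Prop :=
    fun σ x n => abv (σ x - x - (n.val : Qpbar p)) < 1
  have hRadd : ∀ σ τ x n m, R σ x n → R τ x m → R (σ * τ) x (n + m) := by
    intro σ τ x n m h1 h2
    have h3 : abv (σ (τ x - x - (m.val : Qpbar p))) < 1 := by rw [abv_gal habv]; exact h2
    have h4 := zmod_val_natCast (p := p) hna hNp (n.val + m.val)
    have e0 : ((n.val + m.val : ℕ) : ZMod p) = n + m := by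
      rw [Nat.cast_add, ZMod.natCast_zmod_val, ZMod.natCast_zmod_val]
    rw [e0] at h4
    have h5 := S6.add_lt hna (S6.add_lt hna h3 h1) h4
    change abv _ < 1
    convert h5 using 2
    simp only [map_sub, map_natCast, AlgEquiv.mul_apply, Nat.cast_add]
    ring
  let S : AddSubmonoid (ZMod p × ZMod p × ZMod p) :=
    { carrier := {c | ∃ σ, R σ w₁ c.1 ∧ R σ w₂ c.2.1 ∧ R σ w c.2.2}
      zero_mem' := ⟨1, by simp [R], by simp [R], by simp [R]⟩
      add_mem' := by
        rintro x y ⟨σ, h1, h2, h3⟩ ⟨τ, h1', h2', h3'⟩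
        exact ⟨σ * τ, hRadd _ _ _ _ _ h1 h1', hRadd _ _ _ _ _ h2 h2', hRadd _ _ _ _ _ h3 h3'⟩ }
  let S' : Submodule (ZMod p) (ZMod p × ZMod p × ZMod p) :=
    { S with
      smul_mem' := by
        intro c x hx
        have : c • x = c.val • x := by
          rw [← Nat.cast_smul_eq_nsmul (ZMod p)]; simp
        rw [this]
        exact S.nsmul_mem hx c.val }
  obtain ⟨a, b, hab⟩ := lin_alg S' (by
    rintro c ⟨σ, h1, h2, h3⟩
    have f1 : ∀ w, (hPoly p v₁).eval w = 0 → σ w = w := fun w hw =>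
      fix_all ho habv g₁ σ (fun w hw => h_gal (Kur_mem hv₁) σ hw) (g₁.root_rel hw₁)
        (by simpa [R] using h1) hw
    have f2 : ∀ w, (hPoly p v₂).eval w = 0 → σ w = w := fun w hw =>
      fix_all ho habv g₂ σ (fun w hw => h_gal (Kur_mem hv₂) σ hw) (g₂.root_rel hw₂)
        (by simpa [R] using h2) hw
    let F := IntermediateField.fixedField (Subgroup.zpowers σ)
    have memF : ∀ x, x ∈ F ↔ σ x = x := by
      intro x
      rw [IntermediateField.mem_fixedField_iff]
      constructor
      · intro h; exact h σ (Subgroup.mem_zpowers σ)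
      · intro h τ hτ
        have : Subgroup.zpowers σ ≤ MulAction.stabilizer _ x := by
          rw [Subgroup.zpowers_le]; exact h
        exact this hτ
    have hle : Mfield p d (v₁ ^ ((1 : ℤ) - (p : ℤ))) ⊔ Mfield p d (v₂ ^ ((1 : ℤ) - (p : ℤ))) ≤ F :=
      sup_le ((M_le habv hd hv₁ F).2 fun w hw => (memF w).2 (f1 w hw))
        ((M_le habv hd hv₂ F).2 fun w hw => (memF w).2 (f2 w hw))
    have hσw := (memF w).1 ((M_le habv hd hv F).1 (hM.trans hle) w hw)
    have h4 : abv (σ w - w - (c.val : Qpbar p)) < 1 := h3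
    rw [hσw, sub_self] at h4
    refine (zmod_inj (L := Qpbar p) (N := abv) hna hNp ?_).symm
    simpa using h4)
  refine ⟨a, b, ?_⟩
  have hab' : ∀ σ n₁ n₂ n, R σ w₁ n₁ → R σ w₂ n₂ → R σ w n → n = a * n₁ + b * n₂ :=
    fun σ n₁ n₂ n h1 h2 h3 => hab (n₁, n₂, n) ⟨σ, h1, h2, h3⟩
  by_contra hc
  set s := v - (a.val : Qpbar p) * v₁ - (b.val : Qpbar p) * v₂ with hs
  set z := w - (a.val : Qpbar p) * w₁ - (b.val : Qpbar p) * w₂ with hz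
  have hrel : Rel p abv z s := by
    rw [hz, hs, sub_eq_add_neg, sub_eq_add_neg, sub_eq_add_neg (v - _), sub_eq_add_neg v]
    exact ((g.root_rel hw).add ho hna hNp (((g₁.root_rel hw₁).natMul ho hna hNp a.val).neg ho)).add
      ho hna hNp (((g₂.root_rel hw₂).natMul ho hna hNp b.val).neg ho)
  have hs1 : abv s = 1 := le_antisymm hrel.2.1 (not_lt.1 hc)
  have hsK : s ∈ Kur p d :=
    sub_mem (sub_mem (Kur_mem hv) (mul_mem (_root_.natCast_mem _ _) (Kur_mem hv₁)))
      (mul_mem (_root_.natCast_mem _ _) (Kur_mem hv₂))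
  have hσz : ∀ σ : (Qpbar p) ≃ₐ[Kur p d] (Qpbar p), abv (σ z - z) < 1 := by
    intro σ
    obtain ⟨n, hn⟩ := g.diff ho hna hNp (g.root_rel hw) (h_gal (Kur_mem hv) σ hw)
    obtain ⟨n₁, hn₁⟩ := g₁.diff ho hna hNp (g₁.root_rel hw₁) (h_gal (Kur_mem hv₁) σ hw₁)
    obtain ⟨n₂, hn₂⟩ := g₂.diff ho hna hNp (g₂.root_rel hw₂) (h_gal (Kur_mem hv₂) σ hw₂)
    have e := hab' σ n₁ n₂ n hn₁ hn₂ hn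
    have h4 := zmod_val_natCast (p := p) hna hNp (a.val * n₁.val + b.val * n₂.val)
    have e2 : ((a.val * n₁.val + b.val * n₂.val : ℕ) : ZMod p) = n := by
      rw [e]; simp
    rw [e2] at h4
    have h5 := S6.sub_lt hna (S6.sub_lt hna (S6.sub_lt hna hn
      (S6.mul_lt (nat_le hna a.val) hn₁)) (S6.mul_lt (nat_le hna b.val) hn₂)) h4
    convert h5 using 2
    rw [hz]
    simp only [map_sub, map_mul, map_natCast, Nat.cast_add, Nat.cast_mul]
    ring
  have gs := asPoly_good hna hNp hs1.le
  obtain ⟨r, hr, hrz⟩ := gs.near hna hrel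
  have hrK : r ∈ Kur p d := by
    have : r ∈ (⊥ : IntermediateField (Kur p d) (Qpbar p)) := mem_of_fixed _ fun σ _ =>
      fix_all ho habv gs σ (fun w hw => as_gal hsK σ hw) hrel (hσz σ) hr
    obtain ⟨y, hy⟩ := IntermediateField.mem_bot.1 this
    rw [← hy]
    exact y.2
  refine Kur_val hd habv hrK (le_antisymm (gs.bound r hr) ?_)
  obtain ⟨h1, h2⟩ := (gs.root_rel hr).scaled hna hNp
  by_contra hlt
  have h3 : abv (p * r ^ p) < 1 := by
    rw [map_mul, map_pow, hNp, inv_mul_lt_one₀ p_pos]; exact not_le.1 hlt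
  have h4 := S6.sub_lt hna h2 h3
  have h5 : p * r ^ p - -s ^ p - p * r ^ p = s ^ p := by ring
  rw [h5, map_pow, hs1, one_pow] at h4
  exact lt_irrefl _ h4

end Concrete
end S6

/-- let `v, v₁, v₂ ∈ μ_{q-1}` with `v₁ v₂⁻¹ ∉ μ_{p-1}`.  Then `M_{v^{1-p}}`
is contained in the compositum `M_{v₁^{1-p}} ⊔ M_{v₂^{1-p}}` if and only if there are
`a, b ∈ 𝔽_p` with `v̄ = a v̄₁ + b v̄₂` in the residue field `k` (equivalently,
`v - a v₁ - b v₂ ∈ P_K`, i.e. `|v - a v₁ - b v₂| < 1`), i.e. iff `v̄` lies on the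
projective line of `ℙ(k)` through `v̄₁` and `v̄₂`. -/
theorem statement6 (hp : Odd p) (d : ℕ) (hd : 0 < d)
    (abv : AbsoluteValue (Qpbar p) ℝ)
    (habv : ∀ x : ℚ_[p], abv (algebraMap ℚ_[p] (Qpbar p) x) = ‖x‖)
    (v v₁ v₂ : Qpbar p)
    (hv : v ^ (p ^ d - 1) = 1) (hv₁ : v₁ ^ (p ^ d - 1) = 1) (hv₂ : v₂ ^ (p ^ d - 1) = 1)
    (h12 : ¬ (v₁ * v₂⁻¹) ^ (p - 1) = 1) :
    Mfield p d (v ^ ((1 : ℤ) - (p : ℤ))) ≤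
        Mfield p d (v₁ ^ ((1 : ℤ) - (p : ℤ))) ⊔ Mfield p d (v₂ ^ ((1 : ℤ) - (p : ℤ))) ↔
      ∃ a b : ZMod p,
        abv (v - (a.val : Qpbar p) * v₁ - (b.val : Qpbar p) * v₂) < 1 := by
  exact ⟨fun h => S6.main_only_if hp hd habv hv hv₁ hv₂ h,
    fun ⟨a, b, h⟩ => S6.main_if hp hd habv hv hv₁ hv₂ a b h⟩
end

section
/- The extension M_{p,2}/ℚ_p is Galois and weakly ramified: the different of M_{p,2}/ℚ_p equals P^{2(q−1)}, where P is the maximal ideal of the valuation ring of M_{p,2}. Moreover, if d > 1, then Gal(M_{p,2}/ℚ_p) is not abelian. -/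
open Polynomial Filter IntermediateField

variable (p : ℕ) [Fact p.Prime]

/-- `M_{p,2}`: the splitting field over `K`, inside `ℚ̄_p`, of `X (X+p)^{q-1} + p`
(`q = p^d`), viewed as an extension of `ℚ_p`. -/
noncomputable def Mp2 (d : ℕ) : IntermediateField ℚ_[p] (Qpbar p) :=
  (IntermediateField.adjoin (Kur p d)
    {x : Qpbar p | (X * (X + C (p : Qpbar p)) ^ (p ^ d - 1) + C (p : Qpbar p) :
      Polynomial (Qpbar p)).IsRoot x}).restrictScalars ℚ_[p]


namespace S7

section gen
variable {L : Type*} [Field L] (abv : AbsoluteValue L ℝ)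

lemma sum_le (hna : IsNonarchimedean abv) {ι : Type*} (s : Finset ι) (f : ι → L) (C : ℝ) (hC : 0 ≤ C)
    (h : ∀ i ∈ s, abv (f i) ≤ C) : abv (∑ i ∈ s, f i) ≤ C := by
  classical
  induction s using Finset.induction_on with
  | empty => simpa using hC
  | insert a s ha ih =>
    rw [Finset.sum_insert ha]
    refine (hna _ _).trans (max_le (h _ (by simp)) (ih fun i hi => h i (by simp [hi])))

lemma sum_lt (hna : IsNonarchimedean abv) {ι : Type*} (s : Finset ι) (f : ι → L) (C : ℝ) (hC : 0 < C)
    (h : ∀ i ∈ s, abv (f i) < C) : abv (∑ i ∈ s, f i) < C := by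
  classical
  induction s using Finset.induction_on with
  | empty => simpa using hC
  | insert a s ha ih =>
    rw [Finset.sum_insert ha]
    refine (hna _ _).trans_lt (max_lt (h _ (by simp)) (ih fun i hi => h i (by simp [hi])))

lemma sub_le (hna : IsNonarchimedean abv) (x y : L) : abv (x - y) ≤ max (abv x) (abv y) := by
  have := hna x (-y)
  rwa [abv.map_neg, ← sub_eq_add_neg] at this

lemma expansion (hna : IsNonarchimedean abv) (r : ℝ) (hr : 1 < r) (q : ℕ) (hq : 0 < q) (b : L) (hb : abv b = r)
    (a : Fin q → L) (ha : ∀ i, a i = 0 ∨ ∃ k : ℤ, abv (a i) = r ^ ((q : ℤ) * k)) :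
    ∃ i, abv (∑ i, a i * b ^ (i : ℕ)) = abv (a i) * r ^ (i : ℕ) ∧
      ∀ j, abv (a j) * r ^ (j : ℕ) ≤ abv (a i) * r ^ (i : ℕ) := by
  have : Nonempty (Fin q) := ⟨⟨0, hq⟩⟩
  obtain ⟨i, hi⟩ := Finite.exists_max (fun i : Fin q => abv (a i) * r ^ (i : ℕ))
  refine ⟨i, ?_, hi⟩
  have habs : ∀ j, abv (a j * b ^ (j : ℕ)) = abv (a j) * r ^ (j : ℕ) := by
    intro j; rw [map_mul, map_pow, hb]
  have hr0 : 0 < r := by linarith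
  by_cases h0 : a i = 0
  · have : ∀ j, a j = 0 := by
      intro j
      have h1 := hi j
      simp only [h0, map_zero, zero_mul] at h1
      by_contra hne
      have : 0 < abv (a j) * r ^ (j : ℕ) := mul_pos (abv.pos hne) (by positivity)
      linarith
    simp [this]
  · obtain ⟨k, hk⟩ := (ha i).resolve_left h0
    have key : ∀ j, j ≠ i → abv (a j) * r ^ (j : ℕ) < abv (a i) * r ^ (i : ℕ) := by
      intro j hji
      refine lt_of_le_of_ne (hi j) fun heq => ?_
      rcases ha j with hj | ⟨l, hl⟩
      · rw [hj, map_zero, zero_mul] at heq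
        have : 0 < abv (a i) * r ^ (i : ℕ) := mul_pos (abv.pos h0) (by positivity)
        linarith
      · rw [hk, hl, ← zpow_natCast r, ← zpow_natCast r, ← zpow_add₀ hr0.ne', ← zpow_add₀ hr0.ne'] at heq
        have h2 := zpow_right_injective₀ hr0 hr.ne' heq
        apply hji
        have h3 : ((j : ℕ) : ℤ) % q = ((i : ℕ) : ℤ) % q := by
          have := congrArg (· % (q : ℤ)) h2
          simpa using this
        rw [Int.emod_eq_of_lt (by positivity) (by exact_mod_cast j.2),
          Int.emod_eq_of_lt (by positivity) (by exact_mod_cast i.2)] at h3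
        exact Fin.ext (by exact_mod_cast h3)
    rw [← habs i, ← Finset.add_sum_erase _ _ (Finset.mem_univ i)]
    apply hna.add_eq_left_of_lt
    refine sum_lt abv hna _ _ _ (abv.pos ?_) ?_
    · intro h
      have := habs i
      rw [h, map_zero] at this
      have : 0 < abv (a i) * r ^ (i : ℕ) := mul_pos (abv.pos h0) (by positivity)
      linarith
    · intro j hj
      rw [habs, habs]
      exact key j (Finset.ne_of_mem_erase hj)

/-- Differences of solutions of `u^q - u = c`. -/
lemma as_diff (hna : IsNonarchimedean abv) (q : ℕ) (hq : 2 ≤ q) (u v : L) (huv : v ^ q - v = u ^ q - u)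
    (hc : ∀ j, 0 < j → j < q → abv ((q.choose j : L) * u ^ (q - j)) < 1) :
    abv (v - u) ≤ 1 ∧ abv ((v - u) ^ q - (v - u)) < 1 ∧ (v = u ∨ abv (v - u) = 1) := by
  set w := v - u with hw
  have hv : v = w + u := by simp [hw]
  have hexp : w ^ q - w = - ∑ j ∈ Finset.Ioo 0 q, ((q.choose j : L) * u ^ (q - j)) * w ^ j := by
    have h1 := add_pow w u q
    have h2 : Finset.range (q + 1) = insert 0 (insert q (Finset.Ioo 0 q)) := by
      ext x; simp; omega
    rw [h2, Finset.sum_insert (by simp; omega), Finset.sum_insert (by simp)] at h1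
    have h3 : ∑ x ∈ Finset.Ioo 0 q, w ^ x * u ^ (q - x) * (q.choose x : L)
        = ∑ j ∈ Finset.Ioo 0 q, ((q.choose j : L) * u ^ (q - j)) * w ^ j :=
      Finset.sum_congr rfl fun x _ => by ring
    rw [h3, ← hv] at h1
    simp at h1
    rw [h1, hv] at huv
    linear_combination huv
  have hw0 := abv.nonneg w
  have hle : abv w ≤ 1 := by
    by_contra hgt
    push Not at hgt
    have : abv (w ^ q) ≤ abv w ^ (q - 1) := by
      have : w ^ q = w - ∑ j ∈ Finset.Ioo 0 q, ((q.choose j : L) * u ^ (q - j)) * w ^ j := by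
        linear_combination hexp
      rw [this]
      refine (sub_le abv hna _ _).trans (max_le ?_ ?_)
      · exact le_self_pow₀ hgt.le (by omega)
      · refine sum_le abv hna _ _ _ (by positivity) fun j hj => ?_
        rw [Finset.mem_Ioo] at hj
        rw [map_mul, map_pow]
        calc _ ≤ 1 * abv w ^ j := by gcongr; exact (hc j hj.1 hj.2).le
          _ ≤ _ := by rw [one_mul]; exact pow_le_pow_right₀ hgt.le (by omega)
    rw [map_pow] at this
    have h2 : abv w ^ (q - 1) < abv w ^ q := pow_lt_pow_right₀ hgt (by omega)
    linarith
  refine ⟨hle, ?_, ?_⟩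
  · rw [hexp, abv.map_neg]
    refine sum_lt abv hna _ _ _ one_pos fun j hj => ?_
    rw [Finset.mem_Ioo] at hj
    rw [map_mul, map_pow]
    calc _ ≤ abv ((q.choose j : L) * u ^ (q - j)) * 1 := by
          gcongr; exact pow_le_one₀ hw0 hle
      _ < 1 := by rw [mul_one]; exact hc j hj.1 hj.2
  · by_cases hz : w = 0
    · left; rw [hv, hz, zero_add]
    right
    refine le_antisymm hle ?_
    by_contra hlt
    push Not at hlt
    have hpos := abv.pos hz
    have : abv w < abv w := by
      have h1 : w = w ^ q + ∑ j ∈ Finset.Ioo 0 q, ((q.choose j : L) * u ^ (q - j)) * w ^ j := by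
        linear_combination -hexp
      conv_lhs => rw [h1]
      refine (hna _ _).trans_lt (max_lt ?_ ?_)
      · rw [map_pow]
        exact pow_lt_self_of_lt_one₀ hpos hlt (by omega)
      · refine sum_lt abv hna _ _ _ hpos fun j hj => ?_
        rw [Finset.mem_Ioo] at hj
        rw [map_mul, map_pow]
        calc _ ≤ abv ((q.choose j : L) * u ^ (q - j)) * abv w := by
              gcongr; exact pow_le_of_le_one hw0 hle (by omega)
          _ < 1 * abv w := by gcongr; exact hc j hj.1 hj.2
          _ = _ := one_mul _
    exact lt_irrefl _ this

lemma teich [IsAlgClosed L] (q : ℕ) (hq : 2 ≤ q) (w : L)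
    (h : abv (w ^ q - w) < 1) : ∃ θ : L, θ ^ q = θ ∧ abv (w - θ) < 1 := by
  by_contra hcon
  push Not at hcon
  set P : L[X] := X ^ q - X with hP
  have hmon : P.Monic := by
    apply monic_X_pow_sub
    rw [degree_X]; exact_mod_cast hq
  have hs := IsAlgClosed.splits P
  have h1 := hs.eq_prod_roots_of_monic hmon
  have h2 : w ^ q - w = (P.roots.map fun a => w - a).prod := by
    have := congrArg (eval w) h1
    rw [eval_multiset_prod] at this
    simpa [hP, Function.comp_def] using this
  have h3 : ∀ s : Multiset L, (∀ a ∈ s, 1 ≤ abv (w - a)) → 1 ≤ abv ((s.map fun a => w - a).prod) := by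
    intro s
    induction s using Multiset.induction_on with
    | empty => simp
    | cons a s ih =>
      intro hs
      simp only [Multiset.map_cons, Multiset.prod_cons, map_mul]
      exact one_le_mul_of_one_le_of_one_le (hs a (by simp)) (ih fun x hx => hs x (by simp [hx]))
  have h4 := h3 P.roots (fun a ha => hcon a (by
    have := isRoot_of_mem_roots ha
    simp [hP, IsRoot] at this
    linear_combination this))
  rw [← h2] at h4
  linarith

lemma prod_coeff (hna : IsNonarchimedean abv) {ι : Type*} (s : Finset ι) (f : ι → L[X]) (h : ∀ i ∈ s, ∀ n, abv ((f i).coeff n) ≤ 1) :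
    ∀ n, abv ((∏ i ∈ s, f i).coeff n) ≤ 1 := by
  classical
  induction s using Finset.induction_on with
  | empty => intro n; rw [Finset.prod_empty, coeff_one]; split_ifs <;> simp
  | insert a s ha ih =>
    intro n
    rw [Finset.prod_insert ha, coeff_mul]
    refine sum_le abv hna _ _ _ zero_le_one fun x _ => ?_
    rw [map_mul]
    exact mul_le_one₀ (h a (by simp) _) (abv.nonneg _) (ih (fun i hi => h i (by simp [hi])) _)

lemma lagrange_coeff (hna : IsNonarchimedean abv) {ι : Type*} [DecidableEq ι] (s : Finset ι) (v : ι → L) (hv : ∀ i, abv (v i) ≤ 1)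
    (hd : ∀ i j, i ≠ j → abv (v i - v j) = 1) (i : ι) :
    ∀ n, abv ((Lagrange.basis s v i).coeff n) ≤ 1 := by
  unfold Lagrange.basis
  apply prod_coeff abv hna
  intro j hj n
  unfold Lagrange.basisDivisor
  rw [coeff_C_mul, map_mul, map_inv₀, hd i j (Finset.ne_of_mem_erase hj).symm, inv_one, one_mul,
    coeff_sub, coeff_X, coeff_C]
  refine (sub_le abv hna _ _).trans (max_le ?_ ?_)
  · split_ifs <;> simp
  · split_ifs <;> simp [hv]

end gen

section two
variable {L : Type*} [Field L] (abv : AbsoluteValue L ℝ)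

lemma minpoly_AS (hna : IsNonarchimedean abv) {S : Type*} [Field S] [Algebra S L] (r : ℝ) (hr : 1 < r) (q : ℕ) (hq : 2 ≤ q)
    (hS : ∀ x : S, x = 0 ∨ ∃ k : ℤ, abv (algebraMap S L x) = r ^ ((q : ℤ) * k))
    (b : L) (hb : abv b = r) (c : S) (hbc : b ^ q - b + algebraMap S L c = 0) :
    minpoly S b = X ^ q - X + C c := by
  set F : S[X] := X ^ q - X + C c with hF
  have hF' : F = X ^ q - (X - C c) := by rw [hF]; ring
  have hmon : F.Monic := by
    rw [hF']
    apply monic_X_pow_sub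
    rw [degree_X_sub_C]; exact_mod_cast hq
  have hdeg : F.natDegree = q := by
    rw [hF']
    apply natDegree_eq_of_degree_eq_some
    rw [degree_sub_eq_left_of_degree_lt, degree_X_pow]
    rw [degree_X_sub_C, degree_X_pow]; exact_mod_cast hq
  have hroot : aeval b F = 0 := by simpa [hF] using hbc
  have hint : IsIntegral S b := ⟨F, hmon, by simpa [aeval_def] using hroot⟩
  have hdvd : minpoly S b ∣ F := minpoly.dvd S b hroot
  have hge : q ≤ (minpoly S b).natDegree := by
    by_contra hlt
    push Not at hlt
    set n := (minpoly S b).natDegree with hn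
    obtain ⟨i, hi, hmax⟩ := expansion abv hna r hr q (by omega) b hb
      (fun i => algebraMap S L ((minpoly S b).coeff i)) (fun i => by
        rcases hS ((minpoly S b).coeff i) with h | h
        · left; simp [h]
        · right; exact h)
    have hsum : ∑ i : Fin q, algebraMap S L ((minpoly S b).coeff i) * b ^ (i : ℕ) = 0 := by
      have := minpoly.aeval S b
      rw [aeval_eq_sum_range' hlt] at this
      rw [← Fin.sum_univ_eq_sum_range (fun i => (minpoly S b).coeff i • b ^ i)] at this
      simpa [Algebra.smul_def] using this
    have h2 := hmax ⟨n, hlt⟩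
    rw [← hi, hsum, map_zero] at h2
    have h3 : (minpoly S b).coeff n = 1 := minpoly.monic hint
    simp only [h3, map_one, one_mul] at h2
    have : 0 < r ^ n := by positivity
    linarith
  exact (eq_of_monic_of_dvd_of_natDegree_le (minpoly.monic hint) hmon hdvd (by omega)).symm ▸ rfl

/-- traces of powers of an Artin-Schreier like generator -/
lemma trace_pow {K E : Type*} [Field K] [Field E] [Algebra K E] (q : ℕ) (hq : 2 ≤ q)
    (pb : PowerBasis K E) (hdim : pb.dim = q) (c : K)
    (hg : pb.gen ^ q = pb.gen - algebraMap K E c) (i : ℕ) (hi : i < q) :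
    Algebra.trace K E (pb.gen ^ i) = if i = 0 then (q : K) else if i = q - 1 then (q : K) - 1 else 0 := by
  have hrepr : ∀ n (hn : n < q) (j : Fin pb.dim), pb.basis.repr (pb.gen ^ n) j = if n = j then 1 else 0 := by
    intro n hn j
    have : pb.gen ^ n = pb.basis ⟨n, hdim ▸ hn⟩ := by simp
    rw [this, Module.Basis.repr_self, Finsupp.single_apply]
    simp [Fin.ext_iff]
  have hdiag : ∀ j : Fin pb.dim, (Algebra.leftMulMatrix pb.basis (pb.gen ^ i)) j j =
      if i = 0 then 1 else if i = q - 1 then (if (j : ℕ) = 0 then 0 else 1) else 0 := by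
    intro j
    have hj : (j : ℕ) < q := hdim ▸ j.2
    rw [Algebra.leftMulMatrix_eq_repr_mul, PowerBasis.basis_eq_pow, ← pow_add]
    by_cases hlt : i + j < q
    · rw [hrepr _ hlt]
      split_ifs <;> first | rfl | omega
    · have h1 : pb.gen ^ (i + j) = pb.gen ^ (i + j - q + 1) - c • pb.gen ^ (i + j - q) := by
        have : i + (j : ℕ) = (i + j - q) + q := by omega
        conv_lhs => rw [this, pow_add, hg]
        rw [Algebra.smul_def]; ring
      rw [h1, map_sub, map_smul, Finsupp.sub_apply, Finsupp.smul_apply, hrepr _ (by omega),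
        hrepr _ (by omega)]
      have : i + (j : ℕ) - q ≠ j := by omega
      simp only [this, if_false, smul_zero, sub_zero]
      split_ifs <;> first | rfl | omega
  rw [Algebra.trace_eq_matrix_trace pb.basis, Matrix.trace]
  simp only [Matrix.diag_apply, hdiag]
  by_cases h0 : i = 0
  · simp [h0, hdim]
  · simp only [h0, if_false]
    by_cases h1 : i = q - 1
    · simp only [h1, if_true]
      have : ∀ n, n = q → ∑ x : Fin n, (if (x : ℕ) = 0 then (0 : K) else 1) = q - 1 := by
        intro n hn
        obtain ⟨m, rfl⟩ : ∃ m, n = m + 1 := ⟨n - 1, by omega⟩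
        rw [Fin.sum_univ_succ, ← hn]
        simp
      exact this _ hdim
    · simp [h1]

lemma trace_sum {K E : Type*} [Field K] [Field E] [Algebra K E] (q : ℕ) (hq : 2 ≤ q)
    (pb : PowerBasis K E) (hdim : pb.dim = q) (c : K)
    (hg : pb.gen ^ q = pb.gen - algebraMap K E c) (a : Fin q → K) :
    Algebra.trace K E (∑ i, algebraMap K E (a i) * pb.gen ^ (i : ℕ)) =
      q * a ⟨0, by omega⟩ + (q - 1) * a ⟨q - 1, by omega⟩ := by
  have h1 : ∀ i : Fin q, Algebra.trace K E (algebraMap K E (a i) * pb.gen ^ (i : ℕ)) =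
      (if i = ⟨0, by omega⟩ then q * a i else 0) + (if i = ⟨q - 1, by omega⟩ then (q - 1) * a i else 0) := by
    intro i
    rw [← Algebra.smul_def, map_smul, trace_pow q hq pb hdim c hg i i.2]
    simp only [Fin.ext_iff, smul_eq_mul]
    split_ifs <;> first | omega | ring
  rw [map_sum, Finset.sum_congr rfl fun i _ => h1 i, Finset.sum_add_distrib]
  simp

end two

section three
variable {p : ℕ} [Fact p.Prime] {abv : AbsoluteValue (AlgebraicClosure ℚ_[p]) ℝ}

lemma abv_eq (habv : ∀ x : ℚ_[p], abv (algebraMap ℚ_[p] (AlgebraicClosure ℚ_[p]) x) = ‖x‖)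
    (x : AlgebraicClosure ℚ_[p]) : abv x = spectralNorm ℚ_[p] (AlgebraicClosure ℚ_[p]) x :=
  spectralNorm_unique_field_norm_ext habv x

lemma abv_na (habv : ∀ x : ℚ_[p], abv (algebraMap ℚ_[p] (AlgebraicClosure ℚ_[p]) x) = ‖x‖) :
    IsNonarchimedean abv := by
  intro x y
  rw [abv_eq habv, abv_eq habv, abv_eq habv]
  exact isNonarchimedean_spectralNorm x y

lemma abv_inv (habv : ∀ x : ℚ_[p], abv (algebraMap ℚ_[p] (AlgebraicClosure ℚ_[p]) x) = ‖x‖)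
    {K : Type*} [Field K] [Algebra ℚ_[p] K] (σ τ : K →ₐ[ℚ_[p]] AlgebraicClosure ℚ_[p]) (x : K) :
    abv (σ x) = abv (τ x) := by
  rw [abv_eq habv, abv_eq habv, spectralNorm, spectralNorm, minpoly.algHom_eq σ σ.injective,
    minpoly.algHom_eq τ τ.injective]

lemma abv_choose (habv : ∀ x : ℚ_[p], abv (algebraMap ℚ_[p] (AlgebraicClosure ℚ_[p]) x) = ‖x‖)
    (d j : ℕ) (hj : 0 < j) (hjq : j < p ^ d) :
    abv (((p ^ d).choose j : ℕ) : AlgebraicClosure ℚ_[p]) ≤ (p : ℝ)⁻¹ := by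
  obtain ⟨m, hm⟩ := (Fact.out : p.Prime).dvd_choose_pow (n := d) hj.ne' hjq.ne
  have h := habv (((p ^ d).choose j : ℕ) : ℚ_[p])
  rw [map_natCast] at h
  rw [h, hm, Nat.cast_mul, norm_mul, Padic.norm_p]
  have : ‖(m : ℚ_[p])‖ ≤ 1 := by exact_mod_cast Padic.norm_int_le_one (m : ℤ)
  exact mul_le_of_le_one_right (by positivity) this

lemma fix_le {q : ℕ} (hq : 2 ≤ q) {u : AlgebraicClosure ℚ_[p]} (hu : u ^ q = u) : abv u ≤ 1 := by
  by_contra h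
  push Not at h
  have h1 : abv u ^ q = abv u := by rw [← map_pow, hu]
  have : abv u ^ 1 < abv u ^ q := pow_lt_pow_right₀ h (by omega)
  rw [pow_one] at this
  linarith

lemma fix_dist (habv : ∀ x : ℚ_[p], abv (algebraMap ℚ_[p] (AlgebraicClosure ℚ_[p]) x) = ‖x‖)
    {d : ℕ} (hq : 2 ≤ p ^ d) {u v : AlgebraicClosure ℚ_[p]} (hu : u ^ p ^ d = u) (hv : v ^ p ^ d = v)
    (huv : u ≠ v) : abv (u - v) = 1 := by
  refine ((as_diff abv (abv_na habv) (p ^ d) hq v u (by rw [hu, hv]; simp) ?_).2.2).resolve_left huv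
  intro j hj hjq
  rw [map_mul, map_pow]
  have h1 := abv_choose habv d j hj hjq
  have h2 : abv v ^ (p ^ d - j) ≤ 1 := pow_le_one₀ (abv.nonneg _) (fix_le hq hv)
  have hp1 : (1 : ℝ) < p := by exact_mod_cast (Fact.out : p.Prime).one_lt
  calc _ ≤ (p : ℝ)⁻¹ * 1 := by gcongr
    _ < 1 := by rw [mul_one]; exact inv_lt_one_of_one_lt₀ hp1

lemma trace_le (habv : ∀ x : ℚ_[p], abv (algebraMap ℚ_[p] (AlgebraicClosure ℚ_[p]) x) = ‖x‖)
    {K : Type*} [Field K] [Algebra ℚ_[p] K] [FiniteDimensional ℚ_[p] K]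
    (σ₀ : K →ₐ[ℚ_[p]] AlgebraicClosure ℚ_[p]) (ω : K) (hω : abv (σ₀ ω) ≤ 1) :
    ‖Algebra.trace ℚ_[p] K ω‖ ≤ 1 := by
  rw [← habv, trace_eq_sum_embeddings (AlgebraicClosure ℚ_[p])]
  refine sum_le abv (abv_na habv) _ _ _ zero_le_one fun σ _ => ?_
  rwa [abv_inv habv σ σ₀]

lemma unram_value (habv : ∀ x : ℚ_[p], abv (algebraMap ℚ_[p] (AlgebraicClosure ℚ_[p]) x) = ‖x‖)
    {d : ℕ} (hq : 2 ≤ p ^ d)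
    {K : Type*} [Field K] [Algebra ℚ_[p] K] [FiniteDimensional ℚ_[p] K]
    (σ₀ : K →ₐ[ℚ_[p]] AlgebraicClosure ℚ_[p]) (pb : PowerBasis ℚ_[p] K)
    (hg : pb.gen ^ p ^ d = pb.gen) (x : K) : ∃ c : ℚ_[p], abv (σ₀ x) = ‖c‖ := by
  classical
  set v : (K →ₐ[ℚ_[p]] AlgebraicClosure ℚ_[p]) → AlgebraicClosure ℚ_[p] := fun σ => σ pb.gen with hv
  have hinj : Function.Injective v := fun σ τ h => pb.algHom_ext h
  have hfix : ∀ σ, v σ ^ p ^ d = v σ := fun σ => by simp only [hv]; rw [← map_pow, hg]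
  have hv1 : ∀ σ, abv (v σ) ≤ 1 := fun σ => fix_le hq (hfix σ)
  have hcard : Fintype.card (K →ₐ[ℚ_[p]] AlgebraicClosure ℚ_[p]) = pb.dim := by
    rw [AlgHom.card, pb.finrank]
  obtain ⟨f, hf, hfx⟩ := pb.exists_eq_aeval x
  have h1 : f.map (algebraMap ℚ_[p] (AlgebraicClosure ℚ_[p])) =
      Lagrange.interpolate Finset.univ v (fun σ => σ x) := by
    apply Lagrange.eq_interpolate_of_eval_eq _ hinj.injOn
    · rw [Finset.card_univ, hcard]
      refine lt_of_le_of_lt degree_map_le ?_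
      exact lt_of_le_of_lt degree_le_natDegree (by exact_mod_cast hf)
    · intro σ _
      rw [eval_map_algebraMap, hfx, ← aeval_algHom_apply]
  have h2 : ∀ n, ‖f.coeff n‖ ≤ abv (σ₀ x) := by
    intro n
    rw [← habv, ← coeff_map, h1, Lagrange.interpolate_apply, finsetSum_coeff]
    refine sum_le abv (abv_na habv) _ _ _ (abv.nonneg _) fun σ _ => ?_
    rw [coeff_C_mul, map_mul, abv_inv habv σ σ₀]
    exact mul_le_of_le_one_right (abv.nonneg _) (lagrange_coeff abv (abv_na habv) _ v hv1
      (fun i j hij => fix_dist habv hq (hfix i) (hfix j) (hinj.ne hij)) σ n)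
  obtain ⟨n, -, hn⟩ := (Finset.range (f.natDegree + 1)).exists_max_image (fun n => ‖f.coeff n‖) ⟨0, by simp⟩
  refine ⟨f.coeff n, le_antisymm ?_ (h2 n)⟩
  rw [hfx, ← aeval_algHom_apply, aeval_eq_sum_range]
  refine sum_le abv (abv_na habv) _ _ _ (norm_nonneg _) fun i hi => ?_
  rw [Algebra.smul_def, map_mul, habv, map_pow]
  exact (mul_le_of_le_one_right (norm_nonneg _) (pow_le_one₀ (abv.nonneg _) (hv1 σ₀))).trans (hn i hi)

lemma unram_trace (habv : ∀ x : ℚ_[p], abv (algebraMap ℚ_[p] (AlgebraicClosure ℚ_[p]) x) = ‖x‖)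
    {d : ℕ} (hq : 2 ≤ p ^ d)
    {K : Type*} [Field K] [Algebra ℚ_[p] K] [FiniteDimensional ℚ_[p] K]
    (σ₀ : K →ₐ[ℚ_[p]] AlgebraicClosure ℚ_[p]) (pb : PowerBasis ℚ_[p] K)
    (hg : pb.gen ^ p ^ d = pb.gen) :
    ∃ ω : K, abv (σ₀ ω) ≤ 1 ∧ ‖Algebra.trace ℚ_[p] K ω‖ = 1 := by
  classical
  set v : (K →ₐ[ℚ_[p]] AlgebraicClosure ℚ_[p]) → AlgebraicClosure ℚ_[p] := fun σ => σ pb.gen with hv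
  have hinj : Function.Injective v := fun σ τ h => pb.algHom_ext h
  have hfix : ∀ σ, v σ ^ p ^ d = v σ := fun σ => by simp only [hv]; rw [← map_pow, hg]
  have hv1 : ∀ σ, abv (v σ) ≤ 1 := fun σ => fix_le hq (hfix σ)
  by_contra hcon
  push Not at hcon
  have hsm : ∀ j : ℕ, abv (∑ σ, v σ ^ j) < 1 := by
    intro j
    have h0 : abv (σ₀ (pb.gen ^ j)) ≤ 1 := by
      rw [map_pow, map_pow]; exact pow_le_one₀ (abv.nonneg _) (hv1 σ₀)
    have h1 := lt_of_le_of_ne (trace_le habv σ₀ _ h0) (hcon _ h0)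
    rw [← habv, trace_eq_sum_embeddings (AlgebraicClosure ℚ_[p])] at h1
    simpa [hv] using h1
  set ℓ := Lagrange.basis Finset.univ v σ₀ with hℓ
  have h1 : ∑ σ, ℓ.eval (v σ) = 1 := by
    rw [Finset.sum_eq_single σ₀, Lagrange.eval_basis_self hinj.injOn (Finset.mem_univ _)]
    · intro σ _ hne
      exact Lagrange.eval_basis_of_ne hne.symm (Finset.mem_univ _)
    · simp
  have h2 : ∑ σ, ℓ.eval (v σ) = ∑ j ∈ Finset.range (ℓ.natDegree + 1), ℓ.coeff j * ∑ σ, v σ ^ j := by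
    simp_rw [eval_eq_sum_range, Finset.mul_sum]
    rw [Finset.sum_comm]
  have h3 : abv (∑ σ, ℓ.eval (v σ)) < 1 := by
    rw [h2]
    refine sum_lt abv (abv_na habv) _ _ _ one_pos fun j _ => ?_
    rw [map_mul]
    refine lt_of_le_of_lt (mul_le_of_le_one_left (abv.nonneg _) ?_) (hsm j)
    exact lagrange_coeff abv (abv_na habv) _ v hv1
      (fun i j hij => fix_dist habv hq (hfix i) (hfix j) (hinj.ne hij)) σ₀ j
  rw [h1, map_one] at h3
  exact lt_irrefl _ h3

end three

section four
variable {p : ℕ} [Fact p.Prime] {abv : AbsoluteValue (Qpbar p) ℝ}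

lemma two_le_q {d : ℕ} (hd : 0 < d) : 2 ≤ p ^ d :=
  (Fact.out : p.Prime).two_le.trans (Nat.le_self_pow hd.ne' p)

lemma root_iff {d : ℕ} (hd : 0 < d) (x : Qpbar p) :
    (X * (X + C (p : Qpbar p)) ^ (p ^ d - 1) + C (p : Qpbar p) : Polynomial (Qpbar p)).IsRoot x ↔
      ((x + p)⁻¹) ^ p ^ d - (x + p)⁻¹ + (p : Qpbar p)⁻¹ = 0 := by
  have hp0 : (p : Qpbar p) ≠ 0 := by exact_mod_cast (Fact.out : p.Prime).ne_zero
  have hq := two_le_q (p := p) hd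
  simp only [IsRoot, eval_add, eval_mul, eval_X, eval_pow, eval_C]
  by_cases h0 : x + p = 0
  · have h1 : p ^ d - 1 ≠ 0 := by omega
    have h2 : p ^ d ≠ 0 := by omega
    rw [h0, inv_zero, zero_pow h1, zero_pow h2]
    simp [hp0]
  · obtain ⟨y, hy⟩ : ∃ y, y = x + p := ⟨_, rfl⟩
    have hx : x = y - p := by rw [hy]; ring
    rw [← hy] at h0 ⊢
    rw [hx]
    obtain ⟨n, hn⟩ : ∃ n, p ^ d = n + 1 := ⟨p ^ d - 1, by omega⟩
    rw [hn, Nat.add_sub_cancel]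
    have : (y⁻¹) ^ (n + 1) - y⁻¹ + (p : Qpbar p)⁻¹ =
        ((y - p) * y ^ n + p) * ((y⁻¹) ^ (n + 1) * (p : Qpbar p)⁻¹) := by
      have h3 : (y⁻¹) ^ n * y ^ n = 1 := by rw [← mul_pow, inv_mul_cancel₀ h0, one_pow]
      have h4 : y⁻¹ * y = 1 := inv_mul_cancel₀ h0
      have h5 : (p : Qpbar p) * (p : Qpbar p)⁻¹ = 1 := mul_inv_cancel₀ hp0
      rw [pow_succ]
      linear_combination (-(y⁻¹ * (y - p) * (p : Qpbar p)⁻¹)) * h3 - (p : Qpbar p)⁻¹ * h4 - ((y⁻¹) ^ n * y⁻¹ - y⁻¹) * h5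
    rw [this]
    constructor
    · intro h; rw [h, zero_mul]
    · intro h
      exact (mul_eq_zero.1 h).resolve_right (mul_ne_zero (pow_ne_zero _ (inv_ne_zero h0)) (inv_ne_zero hp0))

lemma abv_p (habv : ∀ x : ℚ_[p], abv (algebraMap ℚ_[p] (Qpbar p) x) = ‖x‖) :
    abv (p : Qpbar p) = (p : ℝ)⁻¹ := by
  have := habv (p : ℚ_[p])
  rwa [map_natCast, Padic.norm_p] at this

lemma abv_b (habv : ∀ x : ℚ_[p], abv (algebraMap ℚ_[p] (Qpbar p) x) = ‖x‖)
    {d : ℕ} (hd : 0 < d) {r : ℝ} (hr : 1 < r) (hrq : r ^ p ^ d = p) {b : Qpbar p}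
    (hb : b ^ p ^ d - b + (p : Qpbar p)⁻¹ = 0) : abv b = r := by
  have hna := abv_na habv
  have hq := two_le_q (p := p) hd
  have hp1 : (1 : ℝ) < p := by exact_mod_cast (Fact.out : p.Prime).one_lt
  have h1 : abv (b ^ p ^ d - b) = p := by
    have : b ^ p ^ d - b = - (p : Qpbar p)⁻¹ := by linear_combination hb
    rw [this, abv.map_neg, map_inv₀, abv_p habv, inv_inv]
  have hb1 : 1 < abv b := by
    by_contra h
    push Not at h
    have h2 := sub_le abv hna (b ^ p ^ d) b
    rw [h1, map_pow] at h2
    have h3 := h2.trans (max_le (pow_le_one₀ (abv.nonneg _) h) h)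
    linarith
  have h2 : abv (b ^ p ^ d - b) = abv b ^ p ^ d := by
    rw [sub_eq_add_neg, hna.add_eq_left_of_lt, map_pow]
    rw [abv.map_neg, map_pow]
    calc abv b = abv b ^ 1 := (pow_one _).symm
      _ < _ := pow_lt_pow_right₀ hb1 (by omega)
  rw [h1, ← hrq] at h2
  exact (pow_left_inj₀ (abv.nonneg b) (by linarith) (by omega)).1 h2.symm

lemma b_diff (habv : ∀ x : ℚ_[p], abv (algebraMap ℚ_[p] (Qpbar p) x) = ‖x‖)
    {d : ℕ} (hd : 0 < d) {r : ℝ} (hr : 1 < r) (hrq : r ^ p ^ d = p) {b b' : Qpbar p}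
    (hb : b ^ p ^ d - b + (p : Qpbar p)⁻¹ = 0) (hb' : b' ^ p ^ d - b' + (p : Qpbar p)⁻¹ = 0) :
    abv (b' - b) ≤ 1 ∧ abv ((b' - b) ^ p ^ d - (b' - b)) < 1 ∧ (b' = b ∨ abv (b' - b) = 1) := by
  have hq := two_le_q (p := p) hd
  refine as_diff abv (abv_na habv) (p ^ d) hq b b' (by linear_combination hb' - hb) ?_
  intro j hj hjq
  rw [map_mul, map_pow, abv_b habv hd hr hrq hb]
  have h1 := abv_choose habv d j hj hjq
  have hr0 : 0 < r := by linarith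
  have hp0 : (0 : ℝ) < p := by exact_mod_cast (Fact.out : p.Prime).pos
  calc _ ≤ (p : ℝ)⁻¹ * r ^ (p ^ d - j) := by gcongr
    _ < (p : ℝ)⁻¹ * r ^ p ^ d := by
          gcongr 1
          exact pow_lt_pow_right₀ hr (by omega)
    _ = 1 := by rw [hrq]; exact inv_mul_cancel₀ hp0.ne'

lemma mem_Kur_of_fix {d : ℕ} (hd : 0 < d) {θ : Qpbar p} (h : θ ^ p ^ d = θ) : θ ∈ Kur p d := by
  have hq := two_le_q (p := p) hd
  by_cases h0 : θ = 0
  · rw [h0]; exact zero_mem _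
  · apply subset_adjoin
    have : θ ^ (p ^ d - 1) * θ = 1 * θ := by
      rw [← pow_succ, one_mul, Nat.sub_add_cancel (by omega), h]
    exact mul_right_cancel₀ h0 this

lemma Kur_pb {d : ℕ} (hd : 0 < d) :
    ∃ pb : PowerBasis ℚ_[p] (Kur p d), pb.gen ^ p ^ d = pb.gen := by
  have hq := two_le_q (p := p) hd
  have : NeZero (p ^ d - 1) := ⟨by omega⟩
  have : NeZero ((p ^ d - 1 : ℕ) : Qpbar p) := NeZero.charZero
  obtain ⟨ζ, hζ⟩ := HasEnoughRootsOfUnity.exists_primitiveRoot (Qpbar p) (p ^ d - 1)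
  have hint : IsIntegral ℚ_[p] ζ := Algebra.IsIntegral.isIntegral ζ
  have hK : Kur p d = ℚ_[p]⟮ζ⟯ := by
    apply le_antisymm
    · rw [Kur, adjoin_le_iff]
      intro x hx
      obtain ⟨i, -, rfl⟩ := hζ.eq_pow_of_pow_eq_one hx
      exact pow_mem (mem_adjoin_simple_self _ _) _
    · rw [adjoin_simple_le_iff]
      exact subset_adjoin _ _ hζ.pow_eq_one
  rw [hK]
  refine ⟨adjoin.powerBasis hint, ?_⟩
  rw [adjoin.powerBasis_gen]
  apply Subtype.ext
  simp only [SubmonoidClass.coe_pow, AdjoinSimple.coe_gen]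
  conv_lhs => rw [show p ^ d = (p ^ d - 1) + 1 by omega]
  rw [pow_succ, hζ.pow_eq_one, one_mul]

lemma Qp_value {d : ℕ} {r : ℝ} (hrq : r ^ p ^ d = p) (c : ℚ_[p]) :
    c = 0 ∨ ∃ k : ℤ, ‖c‖ = r ^ (((p ^ d : ℕ) : ℤ) * k) := by
  by_cases hc : c = 0
  · exact Or.inl hc
  · right
    refine ⟨-c.valuation, ?_⟩
    rw [Padic.norm_eq_zpow_neg_valuation hc, zpow_mul, zpow_natCast, hrq]

lemma Kur_value (habv : ∀ x : ℚ_[p], abv (algebraMap ℚ_[p] (Qpbar p) x) = ‖x‖)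
    {d : ℕ} (hd : 0 < d) {r : ℝ} (hrq : r ^ p ^ d = p) (x : Kur p d) :
    x = 0 ∨ ∃ k : ℤ, abv (algebraMap (Kur p d) (Qpbar p) x) = r ^ (((p ^ d : ℕ) : ℤ) * k) := by
  obtain ⟨pb, hg⟩ := Kur_pb (p := p) hd
  have := pb.finite
  obtain ⟨c, hc⟩ := unram_value habv (two_le_q hd) (Kur p d).val pb hg x
  change abv (algebraMap (Kur p d) (Qpbar p) x) = ‖c‖ at hc
  rw [hc]
  rcases Qp_value (d := d) hrq c with h | h
  · left
    rw [h, norm_zero] at hc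
    have := abv.eq_zero.1 hc
    exact (map_eq_zero _).1 this
  · right; exact h

lemma mem_adjoin_b (habv : ∀ x : ℚ_[p], abv (algebraMap ℚ_[p] (Qpbar p) x) = ‖x‖)
    {d : ℕ} (hd : 0 < d) {r : ℝ} (hr : 1 < r) (hrq : r ^ p ^ d = p) {b b' : Qpbar p}
    (hb : b ^ p ^ d - b + (p : Qpbar p)⁻¹ = 0) (hb' : b' ^ p ^ d - b' + (p : Qpbar p)⁻¹ = 0) :
    b' ∈ (Kur p d)⟮b⟯ := by
  have hna := abv_na habv
  obtain ⟨-, h2, -⟩ := b_diff habv hd hr hrq hb hb'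
  obtain ⟨θ, hθ, hlt⟩ := teich abv (p ^ d) (two_le_q hd) _ h2
  have hθK := mem_Kur_of_fix hd hθ
  have : IsScalarTower ℚ_[p] (Kur p d)⟮b⟯ (Qpbar p) := IsScalarTower.of_algebraMap_eq fun x => rfl
  have : Algebra.IsAlgebraic (Kur p d)⟮b⟯ (Qpbar p) :=
    Algebra.IsAlgebraic.tower_top (K := ℚ_[p]) (Kur p d)⟮b⟯
  have : IsAlgClosure (Kur p d)⟮b⟯ (Qpbar p) := ⟨inferInstance, this⟩
  have : IsGalois (Kur p d)⟮b⟯ (Qpbar p) := ⟨⟩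
  have key : b' ∈ Set.range (algebraMap (Kur p d)⟮b⟯ (Qpbar p)) := by
    rw [InfiniteGalois.mem_range_algebraMap_iff_fixed]
    intro σ
    have hσb : σ b = b := σ.commutes ⟨b, mem_adjoin_simple_self _ _⟩
    have hσθ : σ θ = θ := σ.commutes ⟨θ, (Kur p d)⟮b⟯.algebraMap_mem ⟨θ, hθK⟩⟩
    have hσb' : (σ b') ^ p ^ d - σ b' + (p : Qpbar p)⁻¹ = 0 := by
      have := congrArg σ hb'
      simpa using this
    have h3 : abv (σ b' - b - θ) < 1 := by
      have : abv (σ (b' - b - θ)) = abv (b' - b - θ) :=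
        abv_inv habv ((σ.restrictScalars ℚ_[p] : Qpbar p ≃ₐ[ℚ_[p]] Qpbar p) : Qpbar p →ₐ[ℚ_[p]] Qpbar p)
          (AlgHom.id _ _) _
      rw [map_sub σ, map_sub σ, hσb, hσθ] at this
      rwa [this]
    refine ((b_diff habv hd hr hrq hb' hσb').2.2).resolve_right ?_
    have h4 : abv (σ b' - b') < 1 := by
      have : σ b' - b' = (σ b' - b - θ) - (b' - b - θ) := by ring
      rw [this]
      exact (sub_le abv hna _ _).trans_lt (max_lt h3 hlt)
    exact h4.ne
  obtain ⟨y, hy⟩ := key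
  rw [← hy]
  exact y.2

lemma E_eq (habv : ∀ x : ℚ_[p], abv (algebraMap ℚ_[p] (Qpbar p) x) = ‖x‖)
    {d : ℕ} (hd : 0 < d) {r : ℝ} (hr : 1 < r) (hrq : r ^ p ^ d = p) {b : Qpbar p}
    (hb : b ^ p ^ d - b + (p : Qpbar p)⁻¹ = 0) :
    IntermediateField.adjoin (Kur p d)
    {x : Qpbar p | (X * (X + C (p : Qpbar p)) ^ (p ^ d - 1) + C (p : Qpbar p) :
      Polynomial (Qpbar p)).IsRoot x} = (Kur p d)⟮b⟯ := by
  apply le_antisymm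
  · rw [adjoin_le_iff]
    intro x hx
    have hb' := (root_iff hd x).1 hx
    have h1 := mem_adjoin_b habv hd hr hrq hb hb'
    have h2 : x = ((x + p)⁻¹)⁻¹ - p := by rw [inv_inv]; ring
    rw [SetLike.mem_coe, h2]
    exact sub_mem (inv_mem h1) (_root_.natCast_mem _ _)
  · rw [adjoin_simple_le_iff]
    have h1 : b⁻¹ - p ∈ {x : Qpbar p | (X * (X + C (p : Qpbar p)) ^ (p ^ d - 1) + C (p : Qpbar p) :
      Polynomial (Qpbar p)).IsRoot x} := by
      rw [Set.mem_ofPred_eq, root_iff hd]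
      simpa using hb
    have h2 : b = ((b⁻¹ - p) + p)⁻¹ := by simp
    rw [h2]
    exact inv_mem (add_mem (subset_adjoin _ _ h1) (_root_.natCast_mem _ _))

lemma exists_b {d : ℕ} (hd : 0 < d) : ∃ b : Qpbar p, b ^ p ^ d - b + (p : Qpbar p)⁻¹ = 0 := by
  have hq := two_le_q (p := p) hd
  obtain ⟨b, hb⟩ := IsAlgClosed.exists_root (X ^ p ^ d - (X - C (p : Qpbar p)⁻¹)) (by
    rw [degree_sub_eq_left_of_degree_lt, degree_X_pow]
    · exact_mod_cast (by omega)
    · rw [degree_X_sub_C, degree_X_pow]; exact_mod_cast hq)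
  refine ⟨b, ?_⟩
  simp [IsRoot] at hb
  linear_combination hb

lemma Mp2_normal (d : ℕ) : Normal ℚ_[p] (Mp2 p d) := by
  rw [normal_iff_forall_map_le]
  intro σ
  rw [IntermediateField.map_le_iff_le_comap, Mp2, restrictScalars_adjoin, adjoin_le_iff]
  rintro x (hx | hx)
  · have : Kur p d ≤ (Mp2 p d).comap σ := by
      rw [Kur, adjoin_le_iff]
      intro y hy
      have h1 : σ y ∈ Kur p d := by
        apply subset_adjoin
        have : y ^ (p ^ d - 1) = 1 := hy
        rw [Set.mem_ofPred_eq, ← map_pow, this, map_one]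
      exact (IntermediateField.adjoin (Kur p d) _).algebraMap_mem ⟨σ y, h1⟩
    have h2 := this hx
    rwa [Mp2, restrictScalars_adjoin] at h2
  · have : σ x ∈ adjoin (Kur p d) {x : Qpbar p | (X * (X + C (p : Qpbar p)) ^ (p ^ d - 1) + C (p : Qpbar p) :
      Polynomial (Qpbar p)).IsRoot x} := by
      apply subset_adjoin
      have h := congrArg σ (show _ = 0 from hx)
      simp only [Set.mem_ofPred_eq, IsRoot, eval_add, eval_mul, eval_X, eval_pow, eval_C] at h ⊢
      simpa using h
    rw [← restrictScalars_adjoin]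
    exact this

end four

section five
variable {p : ℕ} [Fact p.Prime] {abv : AbsoluteValue (Qpbar p) ℝ}

lemma pb_expand {K E : Type*} [Field K] [Field E] [Algebra K E] (q : ℕ)
    (pb : PowerBasis K E) (hdim : pb.dim = q) (x : E) :
    ∃ a : Fin q → K, x = ∑ i, algebraMap K E (a i) * pb.gen ^ (i : ℕ) := by
  subst hdim
  refine ⟨fun i => pb.basis.repr x i, ?_⟩
  conv_lhs => rw [← pb.basis.sum_repr x]
  simp [Algebra.smul_def]

lemma natDegree_AS {S : Type*} [Field S] (q : ℕ) (hq : 2 ≤ q) (c : S) :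
    (X ^ q - X + C c : S[X]).natDegree = q := by
  have hF' : (X ^ q - X + C c : S[X]) = X ^ q - (X - C c) := by ring
  rw [hF']
  apply natDegree_eq_of_degree_eq_some
  rw [degree_sub_eq_left_of_degree_lt, degree_X_pow]
  rw [degree_X_sub_C, degree_X_pow]; exact_mod_cast hq

lemma norm_q_sub_one {d : ℕ} (hd : 0 < d) : ‖((p ^ d : ℕ) : ℚ_[p]) - 1‖ = 1 := by
  have hp1 : (1 : ℝ) < p := by exact_mod_cast (Fact.out : p.Prime).one_lt
  have h1 : ‖((p ^ d : ℕ) : ℚ_[p])‖ < 1 := by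
    push_cast
    rw [norm_pow, Padic.norm_p]
    exact pow_lt_one₀ (by positivity) (inv_lt_one_of_one_lt₀ hp1) hd.ne'
  have := Padic.add_eq_max_of_ne (p := p) (q := ((p ^ d : ℕ) : ℚ_[p])) (r := -1) (by
    rw [norm_neg, norm_one]; exact h1.ne)
  rw [sub_eq_add_neg, this, norm_neg, norm_one, max_eq_right h1.le]

lemma dual_iff (habv : ∀ x : ℚ_[p], abv (algebraMap ℚ_[p] (Qpbar p) x) = ‖x‖)
    {d : ℕ} (hd : 0 < d) {r : ℝ} (hr : 1 < r) (hrq : r ^ p ^ d = p) {b : Qpbar p}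
    (hb : b ^ p ^ d - b + (p : Qpbar p)⁻¹ = 0) (E : IntermediateField (Kur p d) (Qpbar p))
    (hE : E = (Kur p d)⟮b⟯) (x : E) :
    (∀ y : E, abv (y : Qpbar p) ≤ 1 → ‖Algebra.trace ℚ_[p] E (x * y)‖ ≤ 1) ↔
      abv (x : Qpbar p) ≤ r ^ (2 * (p ^ d - 1)) := by
  subst hE
  have hna := abv_na habv
  have hq := two_le_q (p := p) hd
  have hr0 : 0 < r := by linarith
  have hp0 : (p : ℝ) ≠ 0 := by exact_mod_cast (Fact.out : p.Prime).ne_zero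
  have hp1 : (1 : ℝ) < p := by exact_mod_cast (Fact.out : p.Prime).one_lt
  obtain ⟨pbK, hgK⟩ := Kur_pb (p := p) hd
  have hfinK := pbK.finite
  have hab := abv_b habv hd hr hrq hb
  have hmin := minpoly_AS abv hna r hr (p ^ d) hq (Kur_value habv hd hrq) b hab
    ((p : Kur p d)⁻¹) (by simpa using hb)
  have hint : IsIntegral (Kur p d) b := by
    rw [← minpoly.ne_zero_iff, hmin]
    intro h0
    have := natDegree_AS (p ^ d) hq ((p : Kur p d)⁻¹)
    rw [h0, natDegree_zero] at this
    omega
  obtain ⟨pb, hpb⟩ : ∃ pb, pb = adjoin.powerBasis hint := ⟨_, rfl⟩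
  have hgen : (pb.gen : Qpbar p) = b := by rw [hpb, adjoin.powerBasis_gen]; rfl
  have hdim : pb.dim = p ^ d := by
    rw [hpb, adjoin.powerBasis_dim, hmin, natDegree_AS _ hq]
  have hgq : pb.gen ^ p ^ d = pb.gen - algebraMap (Kur p d) (Kur p d)⟮b⟯ ((p : Kur p d)⁻¹) := by
    apply Subtype.ext
    push_cast
    rw [hgen]
    have h9 : ((algebraMap (Kur p d) (Kur p d)⟮b⟯ ((p : Kur p d)⁻¹) : (Kur p d)⟮b⟯) : Qpbar p) =
        (p : Qpbar p)⁻¹ := by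
      change algebraMap (Kur p d) (Qpbar p) ((p : Kur p d)⁻¹) = _
      rw [map_inv₀, map_natCast]
    have h10 : b ^ p ^ d = b - (p : Qpbar p)⁻¹ := by linear_combination hb
    rw [h10, ← h9]
  have hfinE := pb.finite
  have htower : IsScalarTower ℚ_[p] (Kur p d) (Kur p d)⟮b⟯ := inferInstance
  -- expansion
  have hexp : ∀ z : (Kur p d)⟮b⟯, ∃ a : Fin (p ^ d) → Kur p d,
      z = ∑ i, algebraMap (Kur p d) (Kur p d)⟮b⟯ (a i) * pb.gen ^ (i : ℕ) ∧
      ∃ i, abv (z : Qpbar p) = abv (a i : Qpbar p) * r ^ (i : ℕ) ∧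
      ∀ j, abv (a j : Qpbar p) * r ^ (j : ℕ) ≤ abv (a i : Qpbar p) * r ^ (i : ℕ) := by
    intro z
    obtain ⟨a, ha⟩ := pb_expand (p ^ d) pb hdim z
    refine ⟨a, ha, ?_⟩
    have := expansion abv hna r hr (p ^ d) (by omega) b hab (fun i => (a i : Qpbar p)) (fun i => by
      rcases Kur_value habv hd hrq (a i) with h | h
      · left; simp [h]
      · right; exact h)
    have hz : (z : Qpbar p) = ∑ i, (a i : Qpbar p) * b ^ (i : ℕ) := by
      rw [ha]
      push_cast
      rw [hgen]
      rfl
    rwa [hz]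
  have htr : ∀ a : Fin (p ^ d) → Kur p d, Algebra.trace ℚ_[p] (Kur p d)⟮b⟯
      (∑ i, algebraMap (Kur p d) (Kur p d)⟮b⟯ (a i) * pb.gen ^ (i : ℕ)) =
      Algebra.trace ℚ_[p] (Kur p d) (((p ^ d : ℕ) : Kur p d) * a ⟨0, by omega⟩ +
        (((p ^ d : ℕ) : Kur p d) - 1) * a ⟨p ^ d - 1, by omega⟩) := by
    intro a
    rw [← Algebra.trace_trace (S := Kur p d), trace_sum (p ^ d) hq pb hdim _ hgq]
  constructor
  · intro h
    by_contra hlt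
    push Not at hlt
    obtain ⟨a, ha, i, hi, -⟩ := hexp x
    have hx0 : (x : Qpbar p) ≠ 0 := by
      intro h0
      rw [h0, map_zero] at hlt
      have : 0 < r ^ (2 * (p ^ d - 1)) := by positivity
      linarith
    have hbig : r ^ (2 * (p ^ d - 1) + 1) ≤ abv (x : Qpbar p) := by
      rcases Kur_value habv hd hrq (a i) with h0 | ⟨k, hk⟩
      · rw [h0] at hi
        simp at hi
        exact absurd (by exact_mod_cast hi) hx0
      · change abv (a i : Qpbar p) = _ at hk
        rw [hi, hk, ← zpow_natCast, ← zpow_natCast, ← zpow_add₀ hr0.ne'] at hlt ⊢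
        have h2 := (zpow_lt_zpow_iff_right₀ hr).1 hlt
        apply zpow_le_zpow_right₀ hr.le
        push_cast at h2 ⊢
        omega
    obtain ⟨ω, hω, htω⟩ := unram_trace habv hq (Kur p d).val pbK hgK
    change abv (ω : Qpbar p) ≤ 1 at hω
    set t : (Kur p d)⟮b⟯ := ∑ i : Fin (p ^ d), algebraMap (Kur p d) (Kur p d)⟮b⟯
      ((Pi.single (⟨p ^ d - 1, by omega⟩ : Fin (p ^ d)) ((p : ℚ_[p])⁻¹ • ω) : Fin (p ^ d) → Kur p d) i)
        * pb.gen ^ (i : ℕ) with ht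
    have ht1 : (t : Qpbar p) = (p : Qpbar p)⁻¹ * ω * b ^ (p ^ d - 1) := by
      rw [ht, Finset.sum_eq_single ⟨p ^ d - 1, by omega⟩]
      · rw [Pi.single_eq_same]
        push_cast
        rw [hgen, Algebra.smul_def]
        simp [IntermediateField.algebraMap_apply]
      · intro j _ hj
        rw [Pi.single_eq_of_ne hj]; simp
      · simp
    have ht2 : abv (t : Qpbar p) ≤ abv (x : Qpbar p) := by
      refine le_trans ?_ hbig
      rw [ht1, map_mul, map_mul, map_inv₀, abv_p habv, inv_inv, map_pow, hab]
      calc (p : ℝ) * abv (ω : Qpbar p) * r ^ (p ^ d - 1) ≤ p * 1 * r ^ (p ^ d - 1) := by gcongr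
        _ = r ^ (p ^ d + (p ^ d - 1)) := by rw [mul_one, pow_add, hrq]
        _ = _ := by congr 1; omega
    have ht3 := h (t / x) (by
      push_cast
      rw [map_div₀]
      exact div_le_one_of_le₀ ht2 (abv.nonneg _))
    rw [mul_div_cancel₀ _ (by intro h0; exact hx0 (by rw [h0]; rfl)), ht, htr, Pi.single_eq_same,
      Pi.single_eq_of_ne (by rw [Ne, Fin.ext_iff]; simp only []; omega), mul_zero, zero_add] at ht3
    have h5 : (((p ^ d : ℕ) : Kur p d) - 1) * ((p : ℚ_[p])⁻¹ • ω) =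
        ((((p ^ d : ℕ) : ℚ_[p]) - 1) * (p : ℚ_[p])⁻¹) • ω := by
      rw [mul_smul, Algebra.smul_def (((p ^ d : ℕ) : ℚ_[p]) - 1)]
      simp
    rw [h5, map_smul, smul_eq_mul, norm_mul, norm_mul, norm_q_sub_one hd, htω, norm_inv, Padic.norm_p,
      inv_inv] at ht3
    linarith
  · intro hx y hy
    have hz : abv ((x * y : (Kur p d)⟮b⟯) : Qpbar p) ≤ r ^ (2 * (p ^ d - 1)) := by
      push_cast
      rw [map_mul]
      exact (mul_le_of_le_one_right (abv.nonneg _) hy).trans hx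
    generalize x * y = z at hz
    obtain ⟨a, ha, i, hi, hmax⟩ := hexp z
    rw [ha, htr]
    apply trace_le habv (Kur p d).val
    change abv ((((p ^ d : ℕ) : Kur p d) * a ⟨0, by omega⟩ +
        (((p ^ d : ℕ) : Kur p d) - 1) * a ⟨p ^ d - 1, by omega⟩ : Kur p d) : Qpbar p) ≤ 1
    have hmax' : ∀ j, abv (a j : Qpbar p) * r ^ (j : ℕ) ≤ r ^ (2 * (p ^ d - 1)) :=
      fun j => ((hmax j).trans hi.ge).trans hz
    have hqle : abv ((p ^ d : ℕ) : Qpbar p) ≤ (p : ℝ)⁻¹ := by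
      push_cast
      rw [map_pow, abv_p habv]
      exact pow_le_of_le_one (by positivity) (inv_le_one_of_one_le₀ hp1.le) hd.ne'
    have h0 : abv (a ⟨0, by omega⟩ : Qpbar p) ≤ p := by
      have h1 := hmax' ⟨0, by omega⟩
      rcases Kur_value habv hd hrq (a ⟨0, by omega⟩) with h0 | ⟨k, hk⟩
      · rw [h0]; simp
      · change abv (a ⟨0, _⟩ : Qpbar p) = _ at hk
        rw [hk] at h1 ⊢
        simp only [pow_zero, mul_one] at h1
        rw [← zpow_natCast] at h1
        have h2 := (zpow_le_zpow_iff_right₀ hr).1 h1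
        rw [← hrq, ← zpow_natCast]
        apply zpow_le_zpow_right₀ hr.le
        have h3 : ((p ^ d : ℕ) : ℤ) * k < (p ^ d : ℕ) * 2 := by
          refine lt_of_le_of_lt h2 ?_
          omega
        have h4 : k < 2 := lt_of_mul_lt_mul_left h3 (by positivity)
        calc ((p ^ d : ℕ) : ℤ) * k ≤ (p ^ d : ℕ) * 1 := by gcongr; omega
          _ = _ := mul_one _
    have hl : abv (a ⟨p ^ d - 1, by omega⟩ : Qpbar p) ≤ 1 := by
      have h1 := hmax' ⟨p ^ d - 1, by omega⟩
      rcases Kur_value habv hd hrq (a ⟨p ^ d - 1, by omega⟩) with h0 | ⟨k, hk⟩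
      · rw [h0]; simp
      · change abv (a ⟨p ^ d - 1, _⟩ : Qpbar p) = _ at hk
        rw [hk] at h1 ⊢
        simp only [] at h1
        rw [← zpow_natCast, ← zpow_natCast, ← zpow_add₀ hr0.ne'] at h1
        have h2 := (zpow_le_zpow_iff_right₀ hr).1 h1
        have h3 : ((p ^ d : ℕ) : ℤ) * k < (p ^ d : ℕ) * 1 := by omega
        have h4 : k < 1 := lt_of_mul_lt_mul_left h3 (by positivity)
        rw [← zpow_zero r]
        apply zpow_le_zpow_right₀ hr.le
        exact mul_nonpos_of_nonneg_of_nonpos (by positivity) (by omega)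
    push_cast
    rw [← Nat.cast_pow]
    refine (hna _ _).trans (max_le ?_ ?_)
    · rw [map_mul]
      calc _ ≤ (p : ℝ)⁻¹ * p := by gcongr
        _ = 1 := inv_mul_cancel₀ hp0
    · rw [map_mul]
      refine mul_le_one₀ ?_ (abv.nonneg _) hl
      refine (sub_le abv hna _ _).trans (max_le ?_ (by simp))
      exact hqle.trans (inv_le_one_of_one_le₀ hp1.le)

lemma not_abelian (habv : ∀ x : ℚ_[p], abv (algebraMap ℚ_[p] (Qpbar p) x) = ‖x‖)
    {d : ℕ} (hd : 1 < d) {r : ℝ} (hr : 1 < r) (hrq : r ^ p ^ d = p)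
    {b : Qpbar p} (hb : b ^ p ^ d - b + (p : Qpbar p)⁻¹ = 0)
    (hN : Normal ℚ_[p] ℚ_[p]⟮b⟯) : False := by
  have hd0 : 0 < d := by omega
  have hna := abv_na habv
  have hq := two_le_q (p := p) hd0
  have hr0 : 0 < r := by linarith
  have hS : ∀ x : ℚ_[p], x = 0 ∨ ∃ k : ℤ, abv (algebraMap ℚ_[p] (Qpbar p) x) = r ^ (((p ^ d : ℕ) : ℤ) * k) := by
    intro x; rw [habv]; exact Qp_value hrq x
  have hmin : ∀ b' : Qpbar p, b' ^ p ^ d - b' + (p : Qpbar p)⁻¹ = 0 →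
      minpoly ℚ_[p] b' = X ^ p ^ d - X + C (p : ℚ_[p])⁻¹ := fun b' hb' =>
    minpoly_AS abv hna r hr (p ^ d) hq hS b' (abv_b habv hd0 hr hrq hb') _ (by simpa using hb')
  have hmem : ∀ b' : Qpbar p, b' ^ p ^ d - b' + (p : Qpbar p)⁻¹ = 0 → b' ∈ ℚ_[p]⟮b⟯ := by
    intro b' hb'
    have hconj : IsConjRoot ℚ_[p] b' b := by rw [IsConjRoot, hmin b hb, hmin b' hb']
    obtain ⟨σ, hσ⟩ := isConjRoot_iff_exists_algEquiv.1 hconj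
    have h1 := normal_iff_forall_map_le'.1 hN σ
    rw [← hσ]
    exact h1 ⟨b, mem_adjoin_simple_self _ _, rfl⟩
  have hint : IsIntegral ℚ_[p] b := Algebra.IsIntegral.isIntegral b
  obtain ⟨pb, hpb⟩ : ∃ pb, pb = adjoin.powerBasis hint := ⟨_, rfl⟩
  have hgen : (pb.gen : Qpbar p) = b := by rw [hpb, adjoin.powerBasis_gen]; rfl
  have hdim : pb.dim = p ^ d := by
    rw [hpb, adjoin.powerBasis_dim, hmin b hb, natDegree_AS _ hq]
  have hres : ∀ b' : Qpbar p, b' ^ p ^ d - b' + (p : Qpbar p)⁻¹ = 0 →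
      ∃ n : Fin p, abv (b' - b - ((n : ℕ) : Qpbar p)) < 1 := by
    intro b' hb'
    have hw1 := (b_diff habv hd0 hr hrq hb hb').1
    have hw : b' - b ∈ ℚ_[p]⟮b⟯ := sub_mem (hmem b' hb') (mem_adjoin_simple_self _ _)
    obtain ⟨a, ha⟩ := pb_expand (p ^ d) pb hdim ⟨b' - b, hw⟩
    have hz : b' - b = ∑ i, algebraMap ℚ_[p] (Qpbar p) (a i) * b ^ (i : ℕ) := by
      have := congrArg (Subtype.val) ha
      push_cast at this
      rw [hgen] at this
      exact this
    obtain ⟨i, hi, hmax⟩ := expansion abv hna r hr (p ^ d) (by omega) b (abv_b habv hd0 hr hrq hb)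
      (fun i => algebraMap ℚ_[p] (Qpbar p) (a i)) (fun i => by
        rcases hS (a i) with h | h
        · left; simp [h]
        · right; exact h)
    rw [← hz] at hi
    have hle : ∀ j, abv (algebraMap ℚ_[p] (Qpbar p) (a j)) * r ^ (j : ℕ) ≤ 1 :=
      fun j => ((hmax j).trans hi.ge).trans hw1
    have ha0 : ‖a ⟨0, by omega⟩‖ ≤ 1 := by
      have := hle ⟨0, by omega⟩
      rw [habv] at this
      simpa using this
    have h1 : abv (b' - b - algebraMap ℚ_[p] (Qpbar p) (a ⟨0, by omega⟩)) < 1 := by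
      rw [hz, ← Finset.add_sum_erase _ _ (Finset.mem_univ (⟨0, by omega⟩ : Fin (p ^ d)))]
      simp only [pow_zero, mul_one, add_sub_cancel_left]
      refine sum_lt abv hna _ _ _ one_pos fun j hj => ?_
      have hj0 : (j : ℕ) ≠ 0 := by
        have := Finset.ne_of_mem_erase hj
        rwa [Ne, Fin.ext_iff] at this
      rw [map_mul, map_pow, abv_b habv hd0 hr hrq hb]
      refine lt_of_le_of_ne (hle j) ?_
      rcases hS (a j) with h | ⟨k, hk⟩
      · rw [h]; simp
      · rw [hk, ← zpow_natCast, ← zpow_add₀ hr0.ne']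
        intro heq
        rw [← zpow_zero r] at heq
        have h2 := zpow_right_injective₀ hr0 hr.ne' heq
        have h3 : ((p ^ d : ℕ) : ℤ) ∣ ((j : ℕ) : ℤ) := ⟨-k, by linarith⟩
        have h4 : p ^ d ∣ (j : ℕ) := by exact_mod_cast h3
        exact absurd (Nat.le_of_dvd (by omega) h4) (by have := j.2; omega)
    obtain ⟨n, hn, hn2⟩ := PadicInt.exists_mem_range (p := p) ⟨a ⟨0, by omega⟩, ha0⟩
    refine ⟨⟨n, hn⟩, ?_⟩
    rw [PadicInt.maximalIdeal_eq_span_p, Ideal.mem_span_singleton, ← PadicInt.norm_lt_one_iff_dvd] at hn2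
    have h2 : abv (algebraMap ℚ_[p] (Qpbar p) (a ⟨0, by omega⟩) - (n : Qpbar p)) < 1 := by
      have : algebraMap ℚ_[p] (Qpbar p) (a ⟨0, by omega⟩) - (n : Qpbar p) =
        algebraMap ℚ_[p] (Qpbar p) (a ⟨0, by omega⟩ - n) := by simp
      rw [this, habv]
      exact hn2
    have : b' - b - (n : Qpbar p) = (b' - b - algebraMap ℚ_[p] (Qpbar p) (a ⟨0, by omega⟩)) +
      (algebraMap ℚ_[p] (Qpbar p) (a ⟨0, by omega⟩) - (n : Qpbar p)) := by ring
    rw [this]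
    exact (hna _ _).trans_lt (max_lt h1 h2)
  -- counting
  have hcard : Fintype.card ((minpoly ℚ_[p] b).rootSet (Qpbar p)) = p ^ d := by
    rw [card_rootSet_eq_natDegree (minpoly.irreducible hint).separable (IsAlgClosed.splits _),
      hmin b hb, natDegree_AS _ hq]
  have hroot : ∀ x : (minpoly ℚ_[p] b).rootSet (Qpbar p),
      (x : Qpbar p) ^ p ^ d - x + (p : Qpbar p)⁻¹ = 0 := by
    rintro ⟨x, hx⟩
    have := (mem_rootSet.1 hx).2
    rw [hmin b hb] at this
    simpa using this
  choose f hf using fun x : (minpoly ℚ_[p] b).rootSet (Qpbar p) => hres x (hroot x)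
  have hinj : Function.Injective f := by
    intro x y hxy
    apply Subtype.ext
    refine ((b_diff habv hd0 hr hrq (hroot y) (hroot x)).2.2).resolve_right ?_
    have hx := hf x
    have hy := hf y
    rw [hxy] at hx
    have : (x : Qpbar p) - y = (x - b - ((f y : ℕ) : Qpbar p)) - (y - b - ((f y : ℕ) : Qpbar p)) := by ring
    rw [this]
    exact ((sub_le abv hna _ _).trans_lt (max_lt hx hy)).ne
  have := Fintype.card_le_of_injective f hinj
  rw [hcard, Fintype.card_fin] at this
  have h2 : p ^ 1 < p ^ d := Nat.pow_lt_pow_right (Fact.out : p.Prime).one_lt hd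
  rw [pow_one] at h2
  omega

end five
end S7

/-- `M_{p,2}/ℚ_p` is Galois and weakly ramified, i.e. its different is
`P^{2(q-1)}` where `P` is the maximal ideal of the valuation ring of `M_{p,2}`;
equivalently, the inverse different (the trace-dual of the valuation ring) is
`P^{-2(q-1)} = {x : |x| ≤ p^{2(q-1)/q}}` (recall `M_{p,2}/ℚ_p` has ramification index
`q = p^d`, so `|π| = p^{-1/q}`).  Moreover, if `d > 1` then `Gal(M_{p,2}/ℚ_p)` is not
abelian. -/
theorem statement7 (hp : Odd p) (d : ℕ) (hd : 0 < d)
    (abv : AbsoluteValue (Qpbar p) ℝ)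
    (habv : ∀ x : ℚ_[p], abv (algebraMap ℚ_[p] (Qpbar p) x) = ‖x‖)
    [FiniteDimensional ℚ_[p] (Mp2 p d)] :
    IsGalois ℚ_[p] (Mp2 p d) ∧
    ({x : Mp2 p d | ∀ y : Mp2 p d, abv ↑y ≤ 1 →
        ‖Algebra.trace ℚ_[p] (Mp2 p d) (x * y)‖ ≤ 1} =
      {x : Mp2 p d |
        abv ↑x ≤ (p : ℝ) ^ ((2 * ((p : ℝ) ^ d - 1)) / (p : ℝ) ^ d)}) ∧
    (1 < d → ∃ g h : Mp2 p d ≃ₐ[ℚ_[p]] Mp2 p d, g * h ≠ h * g) := by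
  have hpp : p.Prime := Fact.out
  have hp1 : (1 : ℝ) < p := by exact_mod_cast hpp.one_lt
  have hq := S7.two_le_q (p := p) hd
  have hqR : (0 : ℝ) < (p : ℝ) ^ d := by positivity
  obtain ⟨r, hrdef⟩ : ∃ r : ℝ, r = (p : ℝ) ^ (1 / (p : ℝ) ^ d) := ⟨_, rfl⟩
  have hr : 1 < r := by
    rw [hrdef]; exact Real.one_lt_rpow hp1 (by positivity)
  have hrq : r ^ p ^ d = p := by
    rw [hrdef, ← Real.rpow_natCast, ← Real.rpow_mul (by positivity)]
    push_cast
    rw [one_div, inv_mul_cancel₀ hqR.ne', Real.rpow_one]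
  have hbound : (p : ℝ) ^ ((2 * ((p : ℝ) ^ d - 1)) / (p : ℝ) ^ d) = r ^ (2 * (p ^ d - 1)) := by
    rw [hrdef, ← Real.rpow_natCast ((p : ℝ) ^ (1 / (p : ℝ) ^ d)) (2 * (p ^ d - 1)),
      ← Real.rpow_mul (by positivity)]
    congr 1
    push_cast [Nat.cast_sub (show 1 ≤ p ^ d by omega)]
    ring
  obtain ⟨b, hb⟩ := S7.exists_b (p := p) hd
  have hE := S7.E_eq habv hd hr hrq hb
  have hnorm : Normal ℚ_[p] (Mp2 p d) := S7.Mp2_normal d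
  have hgal : IsGalois ℚ_[p] (Mp2 p d) := ⟨⟩
  refine ⟨hgal, ?_, ?_⟩
  · ext x
    rw [Set.mem_ofPred_eq, Set.mem_ofPred_eq, hbound]
    exact S7.dual_iff habv hd hr hrq hb _ hE x
  · intro hd1
    by_contra hcon
    push Not at hcon
    have hab : IsAbelianGalois ℚ_[p] (Mp2 p d) := { is_comm := ⟨hcon⟩ }
    have hbM : b ∈ Mp2 p d := by
      change b ∈ IntermediateField.adjoin (Kur p d) _
      rw [hE]
      exact mem_adjoin_simple_self _ _
    have hle : ℚ_[p]⟮b⟯ ≤ Mp2 p d := adjoin_simple_le_iff.2 hbM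
    have := IsAbelianGalois.of_algHom (IntermediateField.inclusion hle)
    exact S7.not_abelian habv hd1 hr hrq hb inferInstance
end
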